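/- arXiv:2108.09095 — 3 statements merged into one kernel-verified Lean document; each statement's English description precedes it below -/
import Mathlib

section
/- Let G be a simple graph on n vertices with matching number β, and let q(G) denote the largest eigenvalue of its signless Laplacian matrix Q(G) = D(G) + A(G). If 2β + 2 ≤ n < (5β + 3)/2, then q(G) ≤ 4β, with equality if and only if G is isomorphic to the disjoint union K_{2β+1} ∪ K̄_{n−2β−1}. -/
open scoped Classical

/-- The adjacency matrix of a graph, over ℝ. -/
noncomputable def adjMat {V : Type*} [Fintype V] (G : SimpleGraph V) : Matrix V V ℝ :=
  fun i j => if G.Adj i j then 1 else 0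

/-- The diagonal matrix of vertex degrees, over ℝ. -/
noncomputable def degMat {V : Type*} [Fintype V] (G : SimpleGraph V) : Matrix V V ℝ :=
  fun i j => if i = j then ((G.neighborSet i).ncard : ℝ) else 0

/-- The largest (real) eigenvalue of a matrix. -/
noncomputable def specRad {V : Type*} [Fintype V] (M : Matrix V V ℝ) : ℝ :=
  sSup {t : ℝ | ∃ v : V → ℝ, v ≠ 0 ∧ M.mulVec v = t • v}

/-- The α-spectral radius: the largest eigenvalue of A_α(G) = α·D(G) + A(G). -/
noncomputable def alphaRadius {V : Type*} [Fintype V] (α : ℝ) (G : SimpleGraph V) : ℝ :=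
  specRad (α • degMat G + adjMat G)

/-- The matching number of a graph. -/
noncomputable def matchingNumber {V : Type*} [Fintype V] (G : SimpleGraph V) : ℕ :=
  sSup {m : ℕ | ∃ M : G.Subgraph, M.IsMatching ∧ M.edgeSet.ncard = m}

/-- The join of two graphs. -/
def graphJoin {A B : Type*} (G : SimpleGraph A) (H : SimpleGraph B) : SimpleGraph (A ⊕ B) :=
  SimpleGraph.fromRel (fun x y => match x, y with
    | Sum.inl a, Sum.inl b => G.Adj a b
    | Sum.inr a, Sum.inr b => H.Adj a b
    | _, _ => True)

/-- The disjoint union of two graphs. -/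
def graphSum {A B : Type*} (G : SimpleGraph A) (H : SimpleGraph B) : SimpleGraph (A ⊕ B) :=
  SimpleGraph.fromRel (fun x y => match x, y with
    | Sum.inl a, Sum.inl b => G.Adj a b
    | Sum.inr a, Sum.inr b => H.Adj a b
    | _, _ => False)

/-- The number of odd components of G − S. -/
noncomputable def oddComponentsOutside {V : Type*} [Fintype V] (G : SimpleGraph V) (S : Set V) : ℕ :=
  Set.ncard {c : (G.induce Sᶜ).ConnectedComponent | Odd c.supp.ncard}

/-- The disjoint union of cliques K_{f 0} ∪ ⋯ ∪ K_{f (q-1)}. -/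
def cliquesUnion (q : ℕ) (f : Fin q → ℕ) : SimpleGraph (Σ i : Fin q, Fin (f i)) :=
  SimpleGraph.fromRel (fun x y => x.1 = y.1)

lemma SimpleGraph.Subgraph.IsMatching.ncard_verts_le {V : Type*} [Finite V] {G : SimpleGraph V}
    {M : G.Subgraph} (hM : M.IsMatching) : M.verts.ncard ≤ 2 * M.edgeSet.ncard := by
  have := Fintype.ofFinite V
  rw [hM.verts_eq_biUnion_edgeSet]
  have h : (⋃ e ∈ M.edgeSet, (e : Set V)) =
      ↑(M.edgeSet.toFinset.biUnion fun e => e.toFinset) := by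
    ext v; simp
  rw [h, Set.ncard_coe_finset, Set.ncard_eq_toFinset_card', mul_comm]
  refine Finset.card_biUnion_le_card_mul _ _ _ fun e _ => ?_
  induction e with
  | _ x y => simpa [Sym2.toFinset_mk_eq] using Finset.card_le_two

lemma SimpleGraph.Subgraph.IsMatching.ncard_edgeSet_le_matchingNumber {V : Type*} [Fintype V]
    {G : SimpleGraph V} {M : G.Subgraph} (hM : M.IsMatching) :
    M.edgeSet.ncard ≤ matchingNumber G := by
  refine le_csSup ⟨Nat.card (Sym2 V), ?_⟩ ⟨M, hM, rfl⟩
  rintro _ ⟨M', -, rfl⟩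
  exact Set.ncard_le_card _

lemma graphJoin_adj {A B : Type*} (G : SimpleGraph A) (H : SimpleGraph B) (x y : A ⊕ B) :
    (graphJoin G H).Adj x y ↔ match x, y with
      | Sum.inl a, Sum.inl b => G.Adj a b
      | Sum.inr a, Sum.inr b => H.Adj a b
      | _, _ => True := by
  rcases x with a | a <;> rcases y with b | b <;> simp [graphJoin, SimpleGraph.fromRel_adj]
  · exact ⟨fun h => h.2.elim id fun h => h.symm, fun h => ⟨h.ne, .inl h⟩⟩
  · exact ⟨fun h => h.2.elim id fun h => h.symm, fun h => ⟨h.ne, .inl h⟩⟩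

/-- A perfect matching of `G` joined with `k` vertices restricts to a matching of `G` missing at
most `k` vertices. -/
lemma card_le_of_isPerfectMatching_graphJoin {V W : Type*} [Fintype V] [Fintype W]
    (G : SimpleGraph V) (H : SimpleGraph W) {M : (graphJoin G H).Subgraph}
    (hM : M.IsPerfectMatching) :
    Fintype.card V ≤ 2 * matchingNumber G + Fintype.card W := by
  let N : G.Subgraph :=
    { verts := {v | ∃ w, M.Adj (.inl v) (.inl w)}
      Adj := fun v w => M.Adj (.inl v) (.inl w)
      adj_sub := fun {v w} h => (graphJoin_adj G H _ _).1 h.adj_sub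
      edge_vert := fun {v w} h => ⟨w, h⟩
      symm := ⟨fun v w h => h.symm⟩ }
  have hN : N.IsMatching := by
    rintro v ⟨w, hw⟩
    exact ⟨w, hw, fun y hy => Sum.inl_injective (hM.1.eq_of_adj_left hy hw)⟩
  have hle : N.verts.ncard ≤ 2 * matchingNumber G :=
    hN.ncard_verts_le.trans (Nat.mul_le_mul_left 2 hN.ncard_edgeSet_le_matchingNumber)
  have hcompl : N.vertsᶜ.ncard ≤ Fintype.card W := by
    have hex : ∀ v : V, v ∈ N.vertsᶜ → ∃ w : W, M.Adj (.inl v) (.inr w) := by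
      intro v hv
      obtain ⟨w | w, hw, -⟩ := hM.1 (hM.2 (.inl v))
      · exact absurd ⟨w, hw⟩ hv
      · exact ⟨w, hw⟩
    choose f hf using hex
    rw [← Nat.card_coe_set_eq, ← Nat.card_eq_fintype_card]
    refine Nat.card_le_card_of_injective (fun v : ↑(N.vertsᶜ) => f v v.2) fun a b hab => ?_
    refine Subtype.ext (Sum.inl_injective (hM.1.eq_of_adj_right (hf a a.2) ?_))
    simpa [hab] using hf b b.2
  have := Set.ncard_add_ncard_compl N.verts
  rw [Nat.card_eq_fintype_card] at this
  lia

/-- The nontrivial half of the Tutte–Berge formula: `f` labels the vertices outside the barrier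
`{v | f v = none}` by the component containing them. -/
lemma exists_labelling_of_matchingNumber {V : Type} [Fintype V] (G : SimpleGraph V)
    (h : 2 * matchingNumber G + 2 ≤ Fintype.card V) :
    ∃ (ι : Type) (_ : Fintype ι) (f : V → Option ι),
      (∀ u v, G.Adj u v → f u ≠ none → f v ≠ none → f u = f v) ∧
      Fintype.card V + {v | f v = none}.ncard ≤
        2 * matchingNumber G + {i | Odd {v | f v = some i}.ncard}.ncard := by
  obtain ⟨k, hk⟩ := Nat.exists_eq_add_of_le h
  set J := graphJoin G (⊤ : SimpleGraph (Fin k)) with hJ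
  have hno : ¬ ∃ M : J.Subgraph, M.IsPerfectMatching := by
    rintro ⟨M, hM⟩
    have := card_le_of_isPerfectMatching_graphJoin G _ hM
    simp at this
    lia
  rw [SimpleGraph.tutte] at hno
  push Not at hno
  obtain ⟨S, hS⟩ := hno
  rw [SimpleGraph.IsTutteViolator] at hS
  set K := ((⊤ : J.Subgraph).deleteVerts S).coe with hK
  have hverts : ∀ x, x ∈ ((⊤ : J.Subgraph).deleteVerts S).verts ↔ x ∉ S := by simp
  have hadj : ∀ x y, K.Adj x y ↔ J.Adj x.1 y.1 := by
    rintro ⟨x, hx⟩ ⟨y, hy⟩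
    rw [hverts] at hx hy
    simp [hK, hx, hy]
  have hcard : Nat.card ((⊤ : J.Subgraph).deleteVerts S).verts + S.ncard = Fintype.card V + k := by
    rw [Nat.card_coe_set_eq]
    have : ((⊤ : J.Subgraph).deleteVerts S).verts = Sᶜ := by ext; simp
    rw [this, add_comm, Set.ncard_add_ncard_compl]
    simp
  have hpar := K.odd_ncard_oddComponents
  have hS2 : S.ncard + 2 ≤ K.oddComponents.ncard := by
    rcases Nat.even_or_odd K.oddComponents.ncard with he | ho
    · have := Nat.not_odd_iff_even.1 (hpar.not.1 (Nat.not_odd_iff_even.2 he))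
      grind
    · have := hpar.1 ho
      grind
  have hinr : ∀ a, Sum.inr a ∈ S := by
    intro a
    by_contra ha
    have hsub : ∀ c d : K.ConnectedComponent, c = d := by
      have key : ∀ c : K.ConnectedComponent,
          c = K.connectedComponentMk ⟨.inr a, (hverts _).2 ha⟩ := by
        intro c
        induction c using SimpleGraph.ConnectedComponent.ind with
        | _ x =>
          by_cases hx : x = ⟨.inr a, (hverts _).2 ha⟩
          · rw [hx]
          · refine SimpleGraph.ConnectedComponent.sound (SimpleGraph.Adj.reachable ?_)
            rw [hadj, hJ, graphJoin_adj]
            obtain ⟨x | x, hx'⟩ := x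
            · trivial
            · simpa using hx
      exact fun c d => (key c).trans (key d).symm
    have := (Set.ncard_le_one (Set.toFinite K.oddComponents)).2 fun c _ d _ => hsub c d
    lia
  let f : V → Option K.ConnectedComponent := fun v =>
    if hv : Sum.inl v ∉ S then some (K.connectedComponentMk ⟨.inl v, (hverts _).2 hv⟩) else none
  have hfn : ∀ v, f v = none ↔ Sum.inl v ∈ S := by intro v; simp [f]
  refine ⟨K.ConnectedComponent, Fintype.ofFinite _, f, ?_, ?_⟩
  · intro u v huv hu hv
    rw [ne_eq, hfn] at hu hv
    simp only [f, dif_pos hu, dif_pos hv, Option.some_inj]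
    refine SimpleGraph.ConnectedComponent.sound (SimpleGraph.Adj.reachable ?_)
    rw [hadj, hJ, graphJoin_adj]
    exact huv
  · have hSn : S.ncard = {v | f v = none}.ncard + k := by
      have : S = Sum.inl '' {v | f v = none} ∪ Set.range Sum.inr := by
        ext x
        rcases x with x | x <;> simp [hfn, hinr]
      refine (congrArg Set.ncard this).trans ?_
      rw [Set.ncard_union_eq, Set.ncard_image_of_injective _ Sum.inl_injective,
        ← Set.image_univ, Set.ncard_image_of_injective _ Sum.inr_injective, Set.ncard_univ]
      · simp
      · rw [Set.disjoint_left]; rintro _ ⟨v, -, rfl⟩ ⟨w, hw⟩; cases hw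
    have hodd : K.oddComponents = {i | Odd {v | f v = some i}.ncard} := by
      ext c
      have : Subtype.val '' c.supp = Sum.inl '' {v | f v = some c} := by
        ext x
        rcases x with x | x
        · simp [f, SimpleGraph.ConnectedComponent.mem_supp_iff]
        · simp [hinr]
      have h2 : c.supp.ncard = {v | f v = some c}.ncard := by
        rw [← Set.ncard_image_of_injective c.supp Subtype.val_injective, this,
          Set.ncard_image_of_injective _ Sum.inl_injective]
      simp [SimpleGraph.oddComponents, h2]
    rw [← hodd]
    lia

open scoped Finset

lemma mulVec_degMat_add_adjMat {V : Type*} [Fintype V] (G : SimpleGraph V) (x : V → ℝ) (i : V) :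
    (degMat G + adjMat G).mulVec x i = ∑ j ∈ G.neighborFinset i, (x i + x j) := by
  have hd : (degMat G).mulVec x i = (G.degree i : ℝ) * x i := by
    simp [Matrix.mulVec, dotProduct, degMat, Set.ncard_eq_toFinset_card', 
      ← SimpleGraph.card_neighborFinset_eq_degree, SimpleGraph.neighborFinset]
  have ha : (adjMat G).mulVec x i = ∑ j ∈ G.neighborFinset i, x j := by
    simp [Matrix.mulVec, dotProduct, adjMat, SimpleGraph.neighborFinset_eq_filter,
      Finset.sum_filter]
  rw [Matrix.add_mulVec, Pi.add_apply, hd, ha, Finset.sum_add_distrib]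
  simp

/-- A Collatz–Wielandt bound: a positive vector `x` controls every real eigenvalue of a nonnegative
matrix. -/
lemma exists_mul_le_mulVec {V : Type*} [Fintype V] {M : Matrix V V ℝ} (hM : ∀ i j, 0 ≤ M i j)
    {t : ℝ} {v : V → ℝ} (hv : v ≠ 0) (ht : M.mulVec v = t • v) {x : V → ℝ} (hx : ∀ i, 0 < x i) :
    ∃ i, t * x i ≤ M.mulVec x i := by
  obtain ⟨w, hw⟩ := Function.ne_iff.1 hv
  obtain ⟨i, -, hi⟩ := Finset.exists_max_image Finset.univ (fun i => |v i| / x i) ⟨w, by simp⟩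
  have hr : 0 < |v i| / x i :=
    (div_pos (abs_pos.2 hw) (hx w)).trans_le (hi w (by simp))
  refine ⟨i, le_of_mul_le_mul_left ?_ hr⟩
  calc |v i| / x i * (t * x i) = t * |v i| := by have := (hx i).ne'; field_simp
    _ ≤ |t * v i| := by rw [abs_mul]; gcongr; exact le_abs_self t
    _ = |∑ j, M i j * v j| := by
      rw [← smul_eq_mul, ← Pi.smul_apply, ← ht]; rfl
    _ ≤ ∑ j, |M i j * v j| := Finset.abs_sum_le_sum_abs _ _
    _ ≤ ∑ j, |v i| / x i * (M i j * x j) := by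
      refine Finset.sum_le_sum fun j _ => ?_
      rw [abs_mul, abs_of_nonneg (hM i j), mul_left_comm]
      exact mul_le_mul_of_nonneg_left ((div_le_iff₀ (hx j)).1 (hi j (by simp))) (hM i j)
    _ = |v i| / x i * M.mulVec x i := by rw [← Finset.mul_sum]; rfl

lemma degMat_add_adjMat_nonneg {V : Type*} [Fintype V] (G : SimpleGraph V) (i j : V) :
    0 ≤ (degMat G + adjMat G) i j := by
  rw [Matrix.add_apply, degMat, adjMat]
  positivity

lemma finite_setOf_eigenvalue {V : Type*} [Fintype V] (M : Matrix V V ℝ) :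
    {t : ℝ | ∃ v : V → ℝ, v ≠ 0 ∧ M.mulVec v = t • v}.Finite := by
  refine (Module.End.finite_hasEigenvalue (Matrix.toLin' M)).subset ?_
  rintro t ⟨v, hv, h⟩
  exact Module.End.hasEigenvalue_of_hasEigenvector
    (Module.End.hasEigenvector_iff.2 ⟨Module.End.mem_eigenspace_iff.2 (by simpa using h), hv⟩)

lemma exists_eigenvector_specRad {V : Type*} [Fintype V] {M : Matrix V V ℝ}
    (h : specRad M ≠ 0) : ∃ v : V → ℝ, v ≠ 0 ∧ M.mulVec v = specRad M • v := by
  refine Set.Nonempty.csSup_mem ?_ (finite_setOf_eigenvalue M)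
  by_contra hne
  rw [Set.not_nonempty_iff_eq_empty] at hne
  exact h (by rw [specRad, hne, Real.sSup_empty])

lemma le_specRad {V : Type*} [Fintype V] {M : Matrix V V ℝ} {t : ℝ} {v : V → ℝ} (hv : v ≠ 0)
    (h : M.mulVec v = t • v) : t ≤ specRad M :=
  le_csSup (finite_setOf_eigenvalue M).bddAbove ⟨v, hv, h⟩

lemma sum_add_card_odd_le {ι : Type*} [Fintype ι] (N : ι → ℕ) (T : Finset ι) :
    ∑ i ∈ T, N i + #{i | Odd (N i)} ≤ ∑ i, N i + #T := by
  have h1 : #{i | Odd (N i)} ≤ #T + #{i ∈ Tᶜ | Odd (N i)} := by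
    refine (Finset.card_le_card fun i hi => ?_).trans (Finset.card_union_le T _)
    by_cases h : i ∈ T <;> simp_all
  have h2 : #{i ∈ Tᶜ | Odd (N i)} ≤ ∑ i ∈ Tᶜ, N i := by
    rw [Finset.card_filter]
    refine Finset.sum_le_sum fun i _ => ?_
    split_ifs with h
    · exact h.pos
    · exact Nat.zero_le _
  have h3 := Finset.sum_add_sum_compl T N
  lia

lemma card_none_add_sum_card {V ι : Type*} [Fintype V] [Fintype ι] (f : V → Option ι) :
    #{v | f v = none} + ∑ i, #{v | f v = some i} = Fintype.card V := by
  have := Finset.card_eq_sum_card_fiberwise (f := f) (s := Finset.univ) (t := Finset.univ)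
    fun _ _ => by simp
  rw [← Finset.card_univ, this, Fintype.sum_option]

/-- The bound on the total weight of the components, where a component of order `m` carries weight
`s / (4 * β - s - 2 * (m - 1))` at each of its vertices. -/
lemma sum_component_weights_lt {ι : Type*} [Fintype ι] {N : ι → ℕ} {n s β : ℕ} (hs : 1 ≤ s)
    (hsum : s + ∑ i, N i = n) (hodd : n + s ≤ 2 * β + #{i | Odd (N i)})
    (hN : ∀ i, N i + 2 * s ≤ 2 * β + 1) (h2 : 2 * n < 5 * β + 3) :
    (n : ℝ) + s - 2 + ∑ i, N i * (s / (4 * β - s - 2 * (N i - 1)) : ℝ) < 4 * β := by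
  set k := #{i | Odd (N i)} with hk
  have hsβ : s ≤ β := by
    have := sum_add_card_odd_le N ∅
    simp only [Finset.sum_empty, Finset.card_empty] at this
    lia
  have hs' : (1 : ℝ) ≤ s := by exact_mod_cast hs
  have hsβ' : (s : ℝ) ≤ β := by exact_mod_cast hsβ
  have hD : (0 : ℝ) < 4 * β - s := by linarith
  set A : ℝ := s / (4 * β - s) with hA
  set B : ℝ := (4 * β - s + 2) / (3 * (4 * β - s)) with hB
  have hAB : A ≤ B := by
    rw [hA, hB, div_le_div_iff₀ hD (by positivity)]
    nlinarith
  have hterm : ∀ i, N i * (s / (4 * β - s - 2 * (N i - 1)) : ℝ) ≤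
      B * N i + (if Odd (N i) then A - B else 0) := by
    intro i
    rcases Nat.eq_zero_or_pos (N i) with h0 | h0
    · simp [h0]
    have h0' : (1 : ℝ) ≤ N i := by exact_mod_cast h0
    have hNi : (N i : ℝ) + 2 * s ≤ 2 * β + 1 := by exact_mod_cast hN i
    have hden : 3 * (s : ℝ) ≤ 4 * β - s - 2 * (N i - 1) := by linarith
    have hpos : (0 : ℝ) < 4 * β - s - 2 * (N i - 1) := by linarith
    have key : N i * (s / (4 * β - s - 2 * (N i - 1)) : ℝ) ≤ B * N i + (A - B) := by
      have e1 : N i * (s / (4 * β - s - 2 * (N i - 1)) : ℝ) =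
          A + (N i - 1) * (s * (4 * β - s + 2) / ((4 * β - s - 2 * (N i - 1)) * (4 * β - s))) := by
        rw [hA]
        have := hpos.ne'
        have := hD.ne'
        field_simp
        ring
      have e2 : s * (4 * β - s + 2) / ((4 * β - s - 2 * (N i - 1)) * (4 * β - s)) ≤ B := by
        rw [hB, div_le_div_iff₀ (by positivity) (by positivity)]
        have : 0 ≤ (4 * (β : ℝ) - s + 2) * (4 * β - s) := by nlinarith
        nlinarith
      have e3 := mul_le_mul_of_nonneg_left e2 (sub_nonneg.2 h0')
      linarith
    split_ifs <;> linarith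
  have hsum' : ∑ i, N i * (s / (4 * β - s - 2 * (N i - 1)) : ℝ) ≤
      B * (n - s) + k * (A - B) := by
    refine (Finset.sum_le_sum fun i _ => hterm i).trans_eq ?_
    rw [Finset.sum_add_distrib, ← Finset.mul_sum, ← Finset.sum_filter, Finset.sum_const,
      nsmul_eq_mul, ← hk, ← hsum]
    push_cast
    ring
  have hk' : (n : ℝ) + s - 2 * β ≤ k := by
    have : (n : ℝ) + s ≤ 2 * β + k := by exact_mod_cast hodd
    linarith
  have h2' : 2 * (n : ℝ) < 5 * β + 3 := by exact_mod_cast h2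
  have hkAB := mul_le_mul_of_nonpos_right hk' (sub_nonpos.2 hAB)
  have hfin : (n : ℝ) + s - 2 + (B * (n - s) + (n + s - 2 * β) * (A - B)) < 4 * β := by
    have e : 4 * (β : ℝ) - (n + s - 2 + (B * (n - s) + (n + s - 2 * β) * (A - B))) =
        (2 * (β - s) * (s + 5 * β + 1) + 6 * β * (5 * β + 3 - 2 * n)) / (3 * (4 * β - s)) := by
      rw [hA, hB]
      have := hD.ne'
      field_simp
      ring
    have : 0 < (2 * (β - s) * (s + 5 * β + 1) + 6 * β * (5 * β + 3 - 2 * (n : ℝ))) /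
        (3 * (4 * β - s)) := by
      apply div_pos _ (by positivity)
      have h3 : 0 < 6 * (β : ℝ) * (5 * β + 3 - 2 * n) := by
        apply mul_pos <;> linarith
      have h4 : 0 ≤ 2 * ((β : ℝ) - s) * (s + 5 * β + 1) := by
        apply mul_nonneg <;> linarith
      linarith
    linarith
  linarith

lemma exists_one_lt_add_mul_lt {a b d : ℝ} (hb : 0 ≤ b) (h : a + b < d) :
    ∃ c : ℝ, 1 < c ∧ a + c * b < d := by
  have h0 : 0 < d - (a + b) := sub_pos.2 h
  have h1 : 0 < (d - (a + b)) / (b + 1) := by positivity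
  refine ⟨1 + (d - (a + b)) / (b + 1), by linarith, ?_⟩
  have : (d - (a + b)) / (b + 1) * b < d - (a + b) := by
    rw [div_mul_eq_mul_div, div_lt_iff₀ (by positivity)]
    nlinarith
  linarith

/-- If the barrier `{v | f v = none}` is nonempty, every eigenvalue is smaller than `4 * β`. -/
lemma eigenvalue_lt_of_labelling {V ι : Type*} [Fintype V] [Fintype ι] {G : SimpleGraph V} {β : ℕ}
    {f : V → Option ι} (hf : ∀ u v, G.Adj u v → f u ≠ none → f v ≠ none → f u = f v)
    (hodd : Fintype.card V + #{v | f v = none} ≤ 2 * β + #{i | Odd #{v | f v = some i}})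
    (hs : 1 ≤ #{v | f v = none}) (h2 : 2 * Fintype.card V < 5 * β + 3)
    {t : ℝ} {v : V → ℝ} (hv : v ≠ 0) (ht : (degMat G + adjMat G).mulVec v = t • v) :
    t < 4 * β := by
  set s := #{v | f v = none} with hsdef
  set N : ι → ℕ := fun i => #{v | f v = some i} with hNdef
  have hsum : s + ∑ i, N i = Fintype.card V := card_none_add_sum_card f
  have hN : ∀ i, N i + 2 * s ≤ 2 * β + 1 := by
    intro i
    have := sum_add_card_odd_le N {i}
    simp only [Finset.sum_singleton, Finset.card_singleton] at this
    lia
  have hlt := sum_component_weights_lt hs hsum hodd hN h2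
  set b : ι → ℝ := fun i => s / (4 * β - s - 2 * (N i - 1))
  have hs' : (1 : ℝ) ≤ s := by exact_mod_cast hs
  have hden : ∀ i, 0 < (4 * β - s - 2 * (N i - 1) : ℝ) := by
    intro i
    have : (N i : ℝ) + 2 * s ≤ 2 * β + 1 := by exact_mod_cast hN i
    linarith
  have hbpos : ∀ i, 0 < b i := fun i => div_pos (by linarith) (hden i)
  have hB : 0 ≤ ∑ i, N i * b i := Finset.sum_nonneg fun i _ => by have := hbpos i; positivity
  set B := ∑ i, N i * b i with hBdef
  obtain ⟨c, hc1, hc2⟩ : ∃ c : ℝ, 1 < c ∧ (Fintype.card V : ℝ) + s - 2 + c * B < 4 * β :=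
    exists_one_lt_add_mul_lt hB hlt
  let g : Option ι → ℝ := fun o => o.elim 1 fun i => c * b i
  have hgpos : ∀ o, 0 < g o := by
    rintro (_ | i)
    · exact one_pos
    · exact mul_pos (one_pos.trans hc1) (hbpos i)
  obtain ⟨i, hi⟩ := exists_mul_le_mulVec (degMat_add_adjMat_nonneg G) hv ht
    (x := fun v => g (f v)) fun i => hgpos _
  refine lt_of_mul_lt_mul_right (hi.trans_lt ?_) (hgpos (f i)).le
  rw [mulVec_degMat_add_adjMat]
  rcases hfi : f i with _ | a
  · have h1 : ∑ j ∈ G.neighborFinset i, (g (f i) + g (f j)) + 2 ≤ ∑ j, (1 + g (f j)) := by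
      rw [← Finset.add_sum_erase _ _ (Finset.mem_univ i), hfi]
      have : ∑ j ∈ G.neighborFinset i, (g none + g (f j)) ≤
          ∑ j ∈ Finset.univ.erase i, (1 + g (f j)) := by
        refine Finset.sum_le_sum_of_subset_of_nonneg (fun j hj => ?_) fun j _ _ => ?_
        · have := (G.mem_neighborFinset i j).1 hj
          simpa using this.ne'
        · exact add_nonneg zero_le_one (hgpos _).le
      have h2 : g none = 1 := rfl
      linarith
    have h3 : ∑ j, (1 + g (f j)) = Fintype.card V + s + c * B := by
      rw [Finset.sum_add_distrib, ← Finset.sum_fiberwise' Finset.univ f g, Fintype.sum_option]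
      simp [g, hBdef, Finset.mul_sum, hsdef, hNdef, mul_left_comm, add_assoc]
    rw [hfi] at h1
    have h2 : g none = 1 := rfl
    rw [h2]
    rw [h2] at h1
    linarith
  · have hga : g (some a) = c * b a := rfl
    have h1 : ∑ j ∈ G.neighborFinset i, (g (some a) + g (f j)) + 2 * g (some a) ≤
        s * (g (some a) + 1) + N a * (2 * g (some a)) := by
      have hsub : insert i (G.neighborFinset i) ⊆
          ({v | f v = none} : Finset V) ∪ ({v | f v = some a} : Finset V) := by
        intro j hj
        rcases Finset.mem_insert.1 hj with rfl | hj
        · simp [hfi]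
        · have := hf i j (by simpa using hj) (by simp [hfi])
          by_cases h0 : f j = none
          · simp [h0]
          · simp [← this h0, hfi]
      have hdisj : Disjoint ({v | f v = none} : Finset V) ({v | f v = some a} : Finset V) := by
        rw [Finset.disjoint_filter]
        intro v _ h h'
        simp [h] at h'
      have := Finset.sum_le_sum_of_subset_of_nonneg (f := fun j => g (some a) + g (f j)) hsub
        fun j _ _ => add_nonneg (hgpos _).le (hgpos _).le
      rw [Finset.sum_insert (by simp), Finset.sum_union hdisj] at this
      have e1 : ∑ j with f j = none, (g (some a) + g (f j)) = s * (g (some a) + 1) := by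
        rw [Finset.sum_congr rfl (g := fun _ => g (some a) + 1) (by
          intro j hj; simp [(Finset.mem_filter.1 hj).2, g])]
        simp [hsdef]
        ring
      have e2 : ∑ j with f j = some a, (g (some a) + g (f j)) = N a * (2 * g (some a)) := by
        rw [Finset.sum_congr rfl (g := fun _ => 2 * g (some a)) (by
          intro j hj; rw [(Finset.mem_filter.1 hj).2]; ring)]
        simp [hNdef]
      rw [e1, e2, hfi] at this
      linarith
    have h2 : b a * (4 * β - s - 2 * (N a - 1)) = s := div_mul_cancel₀ _ (hden a).ne'
    rw [hga] at h1 ⊢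
    have h3 : c * s = c * b a * (4 * β - s - 2 * (N a - 1)) := by rw [mul_assoc, h2]
    nlinarith

/-- A maximal entry of an eigenvector for the eigenvalue `2 * d` sits at a vertex of degree `d`, all
of whose neighbours have degree `d` too. -/
lemma exists_degree_eq_of_eigenvalue {V : Type*} [Fintype V] {G : SimpleGraph V} {d : ℕ}
    (hd : ∀ i, G.degree i ≤ d) {v : V → ℝ} (hv : v ≠ 0)
    (ht : (degMat G + adjMat G).mulVec v = (2 * d : ℝ) • v) :
    ∃ i, G.degree i = d ∧ ∀ j, G.Adj i j → G.degree j = d := by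
  obtain ⟨w, hw⟩ := Function.ne_iff.1 hv
  obtain ⟨i, -, hi⟩ := Finset.exists_max_image Finset.univ (fun i => |v i|) ⟨w, by simp⟩
  replace hi : ∀ j, |v j| ≤ |v i| := fun j => hi j (Finset.mem_univ j)
  have hpos : 0 < |v i| := (abs_pos.2 hw).trans_le (hi w)
  have key : ∀ k, |v k| = |v i| → G.degree k = d ∧ ∀ j, G.Adj k j → |v j| = |v i| := by
    intro k hk
    have h1 : 2 * d * |v i| ≤ ∑ j ∈ G.neighborFinset k, (|v i| + |v j|) := by
      have h := congrFun ht k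
      rw [mulVec_degMat_add_adjMat, Pi.smul_apply, smul_eq_mul] at h
      rw [← hk]
      calc
        2 * d * |v k| = |2 * d * v k| := by
          rw [abs_mul, abs_of_nonneg (show (0 : ℝ) ≤ 2 * d by positivity)]
        _ = |∑ j ∈ G.neighborFinset k, (v k + v j)| := by rw [h]
        _ ≤ ∑ j ∈ G.neighborFinset k, |v k + v j| := Finset.abs_sum_le_sum_abs _ _
        _ ≤ _ := Finset.sum_le_sum fun j _ => abs_add_le _ _
    have hle : ∀ j ∈ G.neighborFinset k, |v i| + |v j| ≤ 2 * |v i| := by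
      intro j _; linarith [hi j]
    have h2 : ∑ j ∈ G.neighborFinset k, 2 * |v i| = G.degree k * (2 * |v i|) := by simp
    have h3 : (G.degree k : ℝ) * (2 * |v i|) ≤ d * (2 * |v i|) := by
      have : (G.degree k : ℝ) ≤ d := by exact_mod_cast hd k
      gcongr
    have h4 := Finset.sum_le_sum hle
    refine ⟨?_, fun j hj => ?_⟩
    · refine le_antisymm (hd k) ?_
      have : (d : ℝ) ≤ G.degree k :=
        le_of_mul_le_mul_right (a := 2 * |v i|) (by linarith) (by linarith)
      exact_mod_cast this
    · have h5 := (Finset.sum_eq_sum_iff_of_le hle).1 (by linarith) j (by simpa using hj)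
      linarith
  exact ⟨i, (key i rfl).1, fun j hj => (key j ((key i rfl).2 j hj)).1⟩

lemma graphSum_adj {A B : Type*} (G : SimpleGraph A) (H : SimpleGraph B) (x y : A ⊕ B) :
    (graphSum G H).Adj x y ↔ match x, y with
      | Sum.inl a, Sum.inl b => G.Adj a b
      | Sum.inr a, Sum.inr b => H.Adj a b
      | _, _ => False := by
  rcases x with a | a <;> rcases y with b | b <;> simp [graphSum, SimpleGraph.fromRel_adj]
  · exact ⟨fun h => h.2.elim id fun h => h.symm, fun h => ⟨h.ne, .inl h⟩⟩
  · exact ⟨fun h => h.2.elim id fun h => h.symm, fun h => ⟨h.ne, .inl h⟩⟩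

lemma nonempty_iso_graphSum_top_bot {V : Type*} [Fintype V] {G : SimpleGraph V} {C : Finset V}
    (hG : ∀ u v, G.Adj u v ↔ u ≠ v ∧ u ∈ C ∧ v ∈ C) :
    Nonempty (G ≃g graphSum (⊤ : SimpleGraph (Fin #C))
      (⊥ : SimpleGraph (Fin (Fintype.card V - #C)))) := by
  have e₁ : Fin #C ≃ {v // v ∈ C} := C.equivFin.symm
  have e₂ : Fin (Fintype.card V - #C) ≃ {v // v ∉ C} :=
    (Fintype.equivFinOfCardEq (by rw [Fintype.card_subtype_compl, Fintype.card_coe])).symm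
  refine ⟨SimpleGraph.Iso.symm ⟨(e₁.sumCongr e₂).trans (Equiv.sumCompl (· ∈ C)), ?_⟩⟩
  intro x y
  rw [graphSum_adj, hG]
  rcases x with x | x <;> rcases y with y | y
  · simp [Subtype.ext_iff.symm]
  · simpa using fun _ => (e₂ y).2
  · simpa using fun _ h => absurd h (e₂ x).2
  · simpa using fun _ h => absurd h (e₂ x).2

lemma le_specRad_of_iso_graphSum_top_bot {V : Type*} [Fintype V] {G : SimpleGraph V} {d m : ℕ}
    (e : G ≃g graphSum (⊤ : SimpleGraph (Fin (d + 1))) (⊥ : SimpleGraph (Fin m))) :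
    2 * (d : ℝ) ≤ specRad (degMat G + adjMat G) := by
  set v : V → ℝ := fun i => if (e i).isLeft then 1 else 0 with hvdef
  have hv : v ≠ 0 := by
    refine Function.ne_iff.2 ⟨e.symm (.inl 0), ?_⟩
    simp [v]
  refine le_specRad hv ?_
  ext i
  rw [mulVec_degMat_add_adjMat, Pi.smul_apply, smul_eq_mul]
  rcases hi : e i with a | a
  · have hone : ∀ j ∈ G.neighborFinset i, v i + v j = 2 := by
      intro j hj
      rw [SimpleGraph.mem_neighborFinset, ← e.map_adj_iff, graphSum_adj, hi] at hj
      rcases hj' : e j with b | b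
      · simp [v, hi, hj']; norm_num
      · simp [hj'] at hj
    have hdeg : G.degree i = d := by
      rw [← e.degree_eq, hi, ← SimpleGraph.card_neighborFinset_eq_degree]
      have : (graphSum (⊤ : SimpleGraph (Fin (d + 1))) (⊥ : SimpleGraph (Fin m))).neighborFinset
          (.inl a) = (Finset.univ.erase a).map Function.Embedding.inl := by
        ext x
        rw [SimpleGraph.mem_neighborFinset, graphSum_adj]
        rcases x with x | x <;> simp [eq_comm]
      rw [this]
      simp
    rw [Finset.sum_congr rfl hone]
    simp [hdeg, v, hi, mul_comm]
  · have hempty : G.neighborFinset i = ∅ := by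
      refine Finset.eq_empty_of_forall_notMem fun j hj => ?_
      rw [SimpleGraph.mem_neighborFinset, ← e.map_adj_iff, graphSum_adj, hi] at hj
      rcases hj' : e j with b | b <;> simp [hj'] at hj
    simp [hempty, v, hi]

/-- With an empty barrier, components have at most `2 * β + 1` vertices. -/
lemma degree_le_of_labelling {V ι : Type*} [Fintype V] [Fintype ι] {G : SimpleGraph V} {β : ℕ}
    {f : V → Option ι} (hf : ∀ u v, G.Adj u v → f u = f v) (hnone : ∀ v, f v ≠ none)
    (hodd : Fintype.card V ≤ 2 * β + #{i | Odd #{v | f v = some i}}) (i : V) :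
    G.degree i ≤ 2 * β := by
  obtain ⟨a, ha⟩ := Option.ne_none_iff_exists'.1 (hnone i)
  have hsum := card_none_add_sum_card f
  have h := sum_add_card_odd_le (fun i => #{v | f v = some i}) {a}
  simp only [Finset.sum_singleton, Finset.card_singleton] at h
  have hsub : insert i (G.neighborFinset i) ⊆ ({v | f v = some a} : Finset V) := by
    intro j hj
    rcases Finset.mem_insert.1 hj with rfl | hj
    · simp [ha]
    · simp [← hf i j (by simpa using hj), ha]
  have := Finset.card_le_card hsub
  rw [Finset.card_insert_of_notMem (by simp), SimpleGraph.card_neighborFinset_eq_degree] at this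
  lia

lemma nonempty_iso_of_labelling {V ι : Type*} [Fintype V] [Fintype ι] {G : SimpleGraph V} {β : ℕ}
    {f : V → Option ι} (hf : ∀ u v, G.Adj u v → f u = f v) (hnone : ∀ v, f v ≠ none)
    (hodd : Fintype.card V ≤ 2 * β + #{i | Odd #{v | f v = some i}}) {i : V}
    (hi : G.degree i = 2 * β) (hj : ∀ j, G.Adj i j → G.degree j = 2 * β) :
    Nonempty (G ≃g graphSum (⊤ : SimpleGraph (Fin (2 * β + 1)))
      (⊥ : SimpleGraph (Fin (Fintype.card V - (2 * β + 1))))) := by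
  obtain ⟨a, ha⟩ := Option.ne_none_iff_exists'.1 (hnone i)
  have hsum := card_none_add_sum_card f
  set N : ι → ℕ := fun i => #{v | f v = some i} with hN
  have hNa : N a ≤ 2 * β + 1 := by
    have h := sum_add_card_odd_le N {a}
    simp only [Finset.sum_singleton, Finset.card_singleton] at h
    lia
  have hclosed : ∀ u, f u = some a → G.degree u = 2 * β →
      insert u (G.neighborFinset u) = ({v | f v = some a} : Finset V) := by
    intro u hu hdeg
    refine Finset.eq_of_subset_of_card_le (fun j hj => ?_) ?_
    · rcases Finset.mem_insert.1 hj with rfl | hj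
      · simp [hu]
      · simp [← hf u j (by simpa using hj), hu]
    · rw [Finset.card_insert_of_notMem (by simp), SimpleGraph.card_neighborFinset_eq_degree, hdeg]
      exact hNa
  have hdeg : ∀ u, f u = some a → G.degree u = 2 * β := by
    intro u hu
    have : u ∈ insert i (G.neighborFinset i) := by rw [hclosed i ha hi]; simp [hu]
    rcases Finset.mem_insert.1 this with rfl | h
    · exact hi
    · exact hj u (by simpa using h)
  have hcard : N a = 2 * β + 1 := by
    have := congrArg Finset.card (hclosed i ha hi)
    rw [Finset.card_insert_of_notMem (by simp), SimpleGraph.card_neighborFinset_eq_degree, hi]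
      at this
    exact this.symm
  have hother : ∀ b, b ≠ a → N b ≤ 1 := by
    intro b hb
    have h := sum_add_card_odd_le N {a, b}
    rw [Finset.sum_pair hb.symm, Finset.card_pair hb.symm] at h
    lia
  have hG : ∀ u v, G.Adj u v ↔ u ≠ v ∧ u ∈ ({v | f v = some a} : Finset V) ∧
      v ∈ ({v | f v = some a} : Finset V) := by
    intro u v
    constructor
    · intro huv
      obtain ⟨b, hb⟩ := Option.ne_none_iff_exists'.1 (hnone u)
      have hb' : f v = some b := (hf u v huv).symm.trans hb
      obtain rfl : b = a := by
        by_contra hba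
        exact huv.ne (Finset.card_le_one.1 (hother b hba) u (by simp [hb]) v (by simp [hb']))
      exact ⟨huv.ne, by simp [hb], by simp [hb']⟩
    · rintro ⟨hne, hu, hv⟩
      have hu' : f u = some a := by simpa using hu
      rw [← hclosed u hu' (hdeg u hu')] at hv
      simpa [hne.symm] using hv
  have := nonempty_iso_graphSum_top_bot hG
  rwa [show #{v | f v = some a} = 2 * β + 1 from hcard] at this

theorem stmt9 (n β : ℕ) (G : SimpleGraph (Fin n))
    (hβ : matchingNumber G = β) (h1 : 2 * β + 2 ≤ n)
    (h2 : (n : ℝ) < (5 * β + 3) / 2) :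
    specRad (degMat G + adjMat G) ≤ 4 * β ∧
      (specRad (degMat G + adjMat G) = 4 * β ↔
        Nonempty (G ≃g graphSum (⊤ : SimpleGraph (Fin (2 * β + 1)))
          (⊥ : SimpleGraph (Fin (n - (2 * β + 1)))))) := by
  have h2' : 2 * n < 5 * β + 3 := by
    have : (2 * n : ℝ) < 5 * β + 3 := by linarith
    exact_mod_cast this
  have hβ0 : (0 : ℝ) < 4 * β := by
    have : 0 < β := by lia
    positivity
  obtain ⟨ι, _, f, hf, hodd⟩ := exists_labelling_of_matchingNumber G (by simpa [hβ] using h1)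
  simp only [Set.ncard_eq_toFinset_card', Set.toFinset_ofPred, hβ] at hodd
  rcases Nat.eq_zero_or_pos #{v | f v = none} with hs | hs
  · have hnone : ∀ v, f v ≠ none := by simpa [Finset.filter_eq_empty_iff] using hs
    rw [hs, add_zero] at hodd
    replace hf : ∀ u v, G.Adj u v → f u = f v := fun u v h => hf u v h (hnone u) (hnone v)
    have hdeg := degree_le_of_labelling hf hnone hodd
    have hle : specRad (degMat G + adjMat G) ≤ 4 * β := by
      refine Real.sSup_le ?_ hβ0.le
      rintro t ⟨v, hv, ht⟩
      obtain ⟨i, hi⟩ := exists_mul_le_mulVec (degMat_add_adjMat_nonneg G) hv ht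
        (x := fun _ => 1) fun _ => one_pos
      rw [mulVec_degMat_add_adjMat] at hi
      have : (G.degree i : ℝ) ≤ 2 * β := by exact_mod_cast hdeg i
      simp at hi
      linarith
    refine ⟨hle, fun h => ?_, fun ⟨e⟩ => le_antisymm hle ?_⟩
    · obtain ⟨v, hv, ht⟩ := exists_eigenvector_specRad (h.trans_ne hβ0.ne')
      obtain ⟨i, hi, hj⟩ := exists_degree_eq_of_eigenvalue hdeg hv
        (ht.trans (by rw [h]; push_cast; ring_nf))
      have := nonempty_iso_of_labelling hf hnone hodd hi hj
      rwa [Fintype.card_fin] at this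
    · have := le_specRad_of_iso_graphSum_top_bot e
      push_cast at this
      linarith
  · have hlt : specRad (degMat G + adjMat G) < 4 * β := by
      by_cases h0 : specRad (degMat G + adjMat G) = 0
      · rwa [h0]
      obtain ⟨v, hv, ht⟩ := exists_eigenvector_specRad h0
      exact eigenvalue_lt_of_labelling hf hodd hs (by simpa using h2') hv ht
    refine ⟨hlt.le, fun h => absurd h hlt.ne, fun ⟨e⟩ => ?_⟩
    have := le_specRad_of_iso_graphSum_top_bot e
    push_cast at this
    linarith
end

section
/- Let α ≥ 0 be a real number and let n > β ≥ 1 be integers. Then ρ_α(K_β ∨ K̄_{n−β}) = ( αn + (α+1)β − (α+1) + √( [αn + (α+1)β − (α+1)]² − 4[(α²−1)βn + (α+1)β² − α(α+1)β] ) ) / 2. -/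
open scoped Classical

@[simp] lemma graphJoin_adj_inl {A B : Type*} (G : SimpleGraph A) (H : SimpleGraph B) (a b : A) :
    (graphJoin G H).Adj (Sum.inl a) (Sum.inl b) ↔ G.Adj a b := by
  simp only [graphJoin, SimpleGraph.fromRel_adj, G.adj_comm b a, or_self, ne_eq, Sum.inl.injEq,
    and_iff_right_iff_imp]
  exact fun h => h.ne

@[simp] lemma graphJoin_adj_inr {A B : Type*} (G : SimpleGraph A) (H : SimpleGraph B) (a b : B) :
    (graphJoin G H).Adj (Sum.inr a) (Sum.inr b) ↔ H.Adj a b := by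
  simp only [graphJoin, SimpleGraph.fromRel_adj, H.adj_comm b a, or_self, ne_eq, Sum.inr.injEq,
    and_iff_right_iff_imp]
  exact fun h => h.ne

@[simp] lemma graphJoin_adj_inl_inr {A B : Type*} (G : SimpleGraph A) (H : SimpleGraph B)
    (a : A) (b : B) : (graphJoin G H).Adj (Sum.inl a) (Sum.inr b) := by
  simp [graphJoin]

@[simp] lemma graphJoin_adj_inr_inl {A B : Type*} (G : SimpleGraph A) (H : SimpleGraph B)
    (a : A) (b : B) : (graphJoin G H).Adj (Sum.inr b) (Sum.inl a) := by
  simp [graphJoin]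

lemma mulVec_alphaMatrix_apply {V : Type*} [Fintype V] (α : ℝ) (G : SimpleGraph V) (v : V → ℝ)
    (i : V) : (α • degMat G + adjMat G).mulVec v i =
      α * (G.neighborSet i).ncard * v i + ∑ j, if G.Adj i j then v j else 0 := by
  simp [Matrix.mulVec, dotProduct, degMat, adjMat, add_mul, Finset.sum_add_distrib]

lemma ncard_neighborSet_completeSplit_inr {A B : Type*} [Fintype A] (j : B) :
    ((graphJoin (⊤ : SimpleGraph A) (⊥ : SimpleGraph B)).neighborSet (Sum.inr j)).ncard =
      Fintype.card A := by
  have h : (graphJoin (⊤ : SimpleGraph A) (⊥ : SimpleGraph B)).neighborSet (Sum.inr j) =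
      Set.range Sum.inl := by
    ext (j | j) <;> simp
  rw [h, ← Set.image_univ, Set.ncard_image_of_injective _ Sum.inl_injective, Set.ncard_univ,
    Nat.card_eq_fintype_card]

section CompleteSplit

variable {A B : Type*} [Fintype A] [Fintype B]

lemma ncard_neighborSet_completeSplit_inl (i : A) :
    (((graphJoin (⊤ : SimpleGraph A) (⊥ : SimpleGraph B)).neighborSet (Sum.inl i)).ncard : ℝ) =
      Fintype.card A + Fintype.card B - 1 := by
  have h : (graphJoin (⊤ : SimpleGraph A) (⊥ : SimpleGraph B)).neighborSet (Sum.inl i) =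
      {Sum.inl i}ᶜ := by
    ext (j | j) <;> simp [eq_comm]
  have h' := Set.ncard_add_ncard_compl ({Sum.inl i} : Set (A ⊕ B))
  rw [Set.ncard_singleton, Nat.card_eq_fintype_card, Fintype.card_sum] at h'
  rw [h, eq_sub_iff_add_eq']
  exact_mod_cast h'

lemma mulVec_completeSplit_inl (α : ℝ) (v : A ⊕ B → ℝ) (i : A) :
    (α • degMat (graphJoin (⊤ : SimpleGraph A) (⊥ : SimpleGraph B)) +
        adjMat (graphJoin (⊤ : SimpleGraph A) (⊥ : SimpleGraph B))).mulVec v (Sum.inl i) =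
      (α * (Fintype.card A + Fintype.card B - 1) - 1) * v (Sum.inl i) +
        (∑ a, v (Sum.inl a) + ∑ b, v (Sum.inr b)) := by
  have h : ∑ a : A, (if i = a then 0 else v (Sum.inl a)) =
      ∑ a, v (Sum.inl a) - v (Sum.inl i) := by
    rw [eq_sub_iff_add_eq, ← Finset.sum_ite_eq Finset.univ i (fun a => v (Sum.inl a)) |>.trans
      (if_pos (Finset.mem_univ i)), ← Finset.sum_add_distrib]
    exact Finset.sum_congr rfl fun a _ => by split_ifs <;> simp
  rw [mulVec_alphaMatrix_apply, ncard_neighborSet_completeSplit_inl]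
  simp only [Fintype.sum_sum_type, graphJoin_adj_inl, graphJoin_adj_inl_inr, SimpleGraph.top_adj,
    ne_eq, ite_not, if_true, h]
  ring

lemma mulVec_completeSplit_inr (α : ℝ) (v : A ⊕ B → ℝ) (j : B) :
    (α • degMat (graphJoin (⊤ : SimpleGraph A) (⊥ : SimpleGraph B)) +
        adjMat (graphJoin (⊤ : SimpleGraph A) (⊥ : SimpleGraph B))).mulVec v (Sum.inr j) =
      α * Fintype.card A * v (Sum.inr j) + ∑ a, v (Sum.inl a) := by
  rw [mulVec_alphaMatrix_apply, ncard_neighborSet_completeSplit_inr]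
  simp [Fintype.sum_sum_type]

/-- The α-spectral radius of a complete split graph is the larger root `r` of the characteristic
polynomial of the quotient matrix of its equitable two-part partition. -/
lemma alphaRadius_completeSplit_eq [Nonempty A] [Nonempty B] (α r : ℝ)
    (hr : (r - (α * (Fintype.card A + Fintype.card B - 1) + Fintype.card A - 1)) *
      (r - α * Fintype.card A) = Fintype.card A * Fintype.card B)
    (hrA : α * (Fintype.card A + Fintype.card B - 1) + Fintype.card A - 1 < r)
    (hrB : α * Fintype.card A < r) :
    alphaRadius α (graphJoin (⊤ : SimpleGraph A) (⊥ : SimpleGraph B)) = r := by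
  have hA : (0 : ℝ) < Fintype.card A := by exact_mod_cast Fintype.card_pos
  refine IsGreatest.csSup_eq ⟨⟨Sum.elim (fun _ => r - α * Fintype.card A)
    (fun _ => (Fintype.card A : ℝ)), fun h => ?_, ?_⟩, ?_⟩
  · obtain ⟨b⟩ := ‹Nonempty B›
    exact hA.ne' (congrFun h (Sum.inr b))
  · ext (i | j)
    · rw [mulVec_completeSplit_inl]
      simp only [Sum.elim_inl, Sum.elim_inr, Finset.sum_const, Finset.card_univ, nsmul_eq_mul,
        Pi.smul_apply, smul_eq_mul]
      linear_combination -hr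
    · rw [mulVec_completeSplit_inr]
      simp only [Sum.elim_inl, Sum.elim_inr, Finset.sum_const, Finset.card_univ, nsmul_eq_mul,
        Pi.smul_apply, smul_eq_mul]
      ring
  · rintro t ⟨v, hv, h⟩
    by_contra! ht
    refine hv ?_
    have hl (i : A) := (mulVec_completeSplit_inl α v i).symm.trans (congrFun h (Sum.inl i))
    have hi (j : B) := (mulVec_completeSplit_inr α v j).symm.trans (congrFun h (Sum.inr j))
    simp only [Pi.smul_apply, smul_eq_mul] at hl hi
    have hS := Finset.sum_congr (rfl : (Finset.univ : Finset A) = Finset.univ) fun i _ => hl i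
    have hT := Finset.sum_congr (rfl : (Finset.univ : Finset B) = Finset.univ) fun j _ => hi j
    simp only [Finset.sum_add_distrib, ← Finset.mul_sum, Finset.sum_const, Finset.card_univ,
      nsmul_eq_mul] at hS hT
    generalize ∑ a, v (Sum.inl a) = S at *
    generalize ∑ b, v (Sum.inr b) = T at *
    generalize (Fintype.card A : ℝ) = p at *
    generalize (Fintype.card B : ℝ) = q at *
    have hlt : p * q < (t - (α * (p + q - 1) + p - 1)) * (t - α * p) := by
      rw [← hr]
      nlinarith
    have hS0 : S = 0 := by
      have : ((t - (α * (p + q - 1) + p - 1)) * (t - α * p) - p * q) * S = 0 := by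
        linear_combination (α * p - t) * hS - p * hT
      exact (mul_eq_zero.mp this).resolve_left (by linarith)
    have hT0 : T = 0 := by
      have : p * T = 0 := by
        subst hS0
        linear_combination hS
      exact (mul_eq_zero.mp this).resolve_left hA.ne'
    subst hS0 hT0
    ext (i | j)
    · have : (t - (α * (p + q - 1) - 1)) * v (Sum.inl i) = 0 := by linear_combination -hl i
      exact (mul_eq_zero.mp this).resolve_left (by linarith)
    · have : (t - α * p) * v (Sum.inr j) = 0 := by linear_combination -hi j
      exact (mul_eq_zero.mp this).resolve_left (by linarith)

end CompleteSplit

theorem stmt12 (α : ℝ) (hα : 0 ≤ α) (n β : ℕ) (hβ : 1 ≤ β) (hn : β < n) :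
    alphaRadius α (graphJoin (⊤ : SimpleGraph (Fin β)) (⊥ : SimpleGraph (Fin (n - β)))) =
      (α * n + (α + 1) * β - (α + 1) +
        Real.sqrt ((α * n + (α + 1) * β - (α + 1)) ^ 2 -
          4 * ((α ^ 2 - 1) * β * n + (α + 1) * β ^ 2 - α * (α + 1) * β))) / 2 := by
  obtain ⟨m, rfl⟩ := Nat.exists_eq_add_of_lt hn
  have : NeZero β := ⟨by omega⟩
  have : NeZero (β + m + 1 - β) := ⟨by omega⟩
  have hcard : ((β + m + 1 - β : ℕ) : ℝ) = m + 1 := by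
    rw [show β + m + 1 - β = m + 1 by omega]
    push_cast
    rfl
  have hβ' : (0 : ℝ) < β := by exact_mod_cast hβ
  have hm : (0 : ℝ) < m + 1 := by positivity
  have hprod := mul_pos hβ' hm
  have hdisc : (α * ((β + m + 1 : ℕ) : ℝ) + (α + 1) * β - (α + 1)) ^ 2 -
      4 * ((α ^ 2 - 1) * β * ((β + m + 1 : ℕ) : ℝ) + (α + 1) * β ^ 2 - α * (α + 1) * β) =
      (α * (β + m) + β - 1 - α * β) ^ 2 + 4 * (β * (m + 1)) := by
    push_cast
    ring
  have hpos : 0 < (α * (β + m) + β - 1 - α * β) ^ 2 + 4 * (β * (m + 1) : ℝ) := by positivity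
  rw [hdisc]
  have hsq := Real.sq_sqrt hpos.le
  have habs := abs_lt.mp (Real.lt_sqrt (abs_nonneg (α * (β + m) + β - 1 - α * β)) |>.mpr
    (by rw [sq_abs]; linarith : _ < (α * (β + m) + β - 1 - α * β) ^ 2 + 4 * (β * (m + 1) : ℝ)))
  generalize Real.sqrt _ = s at *
  apply alphaRadius_completeSplit_eq <;> simp only [Fintype.card_fin, hcard] <;> push_cast
  · linear_combination hsq / 4
  · linarith [habs.2]
  · linarith [habs.1]
end

section
/- Let α ≥ 0 be a real number and let β ≥ 1 and n ≥ 2β + 1 be integers. Suppose G maximizes the α-spectral radius ρ_α among all simple graphs on n vertices with matching number β, and that the Tutte–Berge minimum min_{S ⊆ V(G)} ( n − o(G−S) + |S| ) is attained at a set S of size s ≥ 1; set q = n + s − 2β. Then G is isomorphic to the join K_s ∨ (K_{2β−2s+1} ∪ K̄_{q−1}). -/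
open scoped Classical

section Spectral

variable {V : Type*} [Fintype V]

theorem specRad_isGreatest [Nonempty V] {M : Matrix V V ℝ} (hM : M.IsHermitian) :
    IsGreatest {t : ℝ | ∃ v : V → ℝ, v ≠ 0 ∧ M.mulVec v = t • v} (specRad M) := by
  have hset : {t : ℝ | ∃ v : V → ℝ, v ≠ 0 ∧ M.mulVec v = t • v} =
      {t : ℝ | Module.End.HasEigenvalue (Matrix.toLin' M) t} := by
    ext t
    constructor
    · rintro ⟨v, hv, h⟩
      exact Module.End.hasEigenvalue_of_hasEigenvector
        ⟨Module.End.mem_eigenspace_iff.2 (by simpa using h), hv⟩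
    · intro h
      obtain ⟨v, hv⟩ := h.exists_hasEigenvector
      exact ⟨v, hv.2, by simpa using Module.End.mem_eigenspace_iff.1 hv.1⟩
  have hfin : {t : ℝ | ∃ v : V → ℝ, v ≠ 0 ∧ M.mulVec v = t • v}.Finite := by
    rw [hset]
    exact Module.End.finite_hasEigenvalue _
  have hne : {t : ℝ | ∃ v : V → ℝ, v ≠ 0 ∧ M.mulVec v = t • v}.Nonempty := by
    obtain ⟨i⟩ := ‹Nonempty V›
    refine ⟨hM.eigenvalues i, _, ?_, hM.mulVec_eigenvectorBasis i⟩
    intro h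
    apply hM.eigenvectorBasis.orthonormal.ne_zero i
    ext j
    exact congrFun h j
  exact ⟨hne.csSup_mem hfin, fun t ht => le_csSup hfin.bddAbove ht⟩

theorem posSemidef_specRad_smul_one_sub {M : Matrix V V ℝ} (hM : M.IsHermitian) :
    (specRad M • (1 : Matrix V V ℝ) - M).PosSemidef := by
  have hH : (specRad M • (1 : Matrix V V ℝ) - M).IsHermitian :=
    (Matrix.isHermitian_one.smul (IsSelfAdjoint.all (specRad M))).sub hM
  rw [hH.posSemidef_iff_eigenvalues_nonneg]
  intro i
  have : Nonempty V := ⟨i⟩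
  have h := hH.mulVec_eigenvectorBasis i
  have h0 : specRad M - hH.eigenvalues i ≤ specRad M := by
    apply (specRad_isGreatest hM).2
    refine ⟨(hH.eigenvectorBasis i).ofLp,
      fun h => hH.eigenvectorBasis.orthonormal.ne_zero i ?_, ?_⟩
    · ext j
      exact congrFun h j
    · rw [Matrix.sub_mulVec, Matrix.smul_mulVec, Matrix.one_mulVec] at h
      rw [sub_smul, ← h]
      abel
  change 0 ≤ hH.eigenvalues i
  linarith

theorem dotProduct_mulVec_specRad_sub {M : Matrix V V ℝ} (x : V → ℝ) :
    star x ⬝ᵥ ((specRad M • (1 : Matrix V V ℝ) - M).mulVec x) =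
      specRad M * (x ⬝ᵥ x) - x ⬝ᵥ M.mulVec x := by
  rw [Matrix.sub_mulVec, Matrix.smul_mulVec, Matrix.one_mulVec, dotProduct_sub, dotProduct_smul]
  simp

theorem dotProduct_mulVec_le_specRad {M : Matrix V V ℝ} (hM : M.IsHermitian) (x : V → ℝ) :
    x ⬝ᵥ M.mulVec x ≤ specRad M * (x ⬝ᵥ x) := by
  have h := (posSemidef_specRad_smul_one_sub hM).dotProduct_mulVec_nonneg x
  rw [dotProduct_mulVec_specRad_sub] at h
  linarith

theorem mulVec_eq_specRad_smul {M : Matrix V V ℝ} (hM : M.IsHermitian) {x : V → ℝ}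
    (h : specRad M * (x ⬝ᵥ x) ≤ x ⬝ᵥ M.mulVec x) : M.mulVec x = specRad M • x := by
  have h1 := ((posSemidef_specRad_smul_one_sub hM).dotProduct_mulVec_zero_iff x).1 (by
    rw [dotProduct_mulVec_specRad_sub]
    linarith [dotProduct_mulVec_le_specRad hM x])
  rw [Matrix.sub_mulVec, Matrix.smul_mulVec, Matrix.one_mulVec, sub_eq_zero] at h1
  exact h1.symm

/-- A symmetric matrix with nonnegative entries has a nonnegative eigenvector for its largest
eigenvalue. -/
theorem exists_nonneg_eigenvector [Nonempty V] {M : Matrix V V ℝ} (hM : M.IsHermitian)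
    (h0 : ∀ i j, 0 ≤ M i j) :
    ∃ x : V → ℝ, x ≠ 0 ∧ (∀ i, 0 ≤ x i) ∧ M.mulVec x = specRad M • x := by
  obtain ⟨v, hv, h⟩ := (specRad_isGreatest hM).1
  refine ⟨fun i => |v i|, fun h => hv ?_, fun i => abs_nonneg _, mulVec_eq_specRad_smul hM ?_⟩
  · ext i
    exact abs_eq_zero.1 (congrFun h i)
  · have e1 : (fun i => |v i|) ⬝ᵥ (fun i => |v i|) = v ⬝ᵥ v := by
      simp [dotProduct]
    have e2 : specRad M * (v ⬝ᵥ v) = v ⬝ᵥ M.mulVec v := by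
      rw [h, dotProduct_smul, smul_eq_mul]
    rw [e1, e2]
    simp only [dotProduct, Matrix.mulVec, Finset.mul_sum]
    refine Finset.sum_le_sum fun i _ => Finset.sum_le_sum fun j _ => ?_
    calc v i * (M i j * v j) ≤ |v i * (M i j * v j)| := le_abs_self _
      _ = |v i| * (M i j * |v j|) := by rw [abs_mul, abs_mul, abs_of_nonneg (h0 i j)]

theorem alphaMat_isHermitian (α : ℝ) (G : SimpleGraph V) :
    (α • degMat G + adjMat G).IsHermitian := by
  ext i j
  by_cases h : i = j
  · subst h; simp
  · simp [degMat, adjMat, h, Ne.symm h, G.adj_comm]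

theorem alphaMat_nonneg {α : ℝ} (hα : 0 ≤ α) (G : SimpleGraph V) (i j : V) :
    0 ≤ (α • degMat G + adjMat G) i j := by
  simp only [Matrix.add_apply, Matrix.smul_apply, degMat, adjMat, smul_eq_mul]
  positivity

theorem alphaMat_mulVec (α : ℝ) (G : SimpleGraph V) (x : V → ℝ) (i : V) :
    (α • degMat G + adjMat G).mulVec x i = ∑ j, if G.Adj i j then α * x i + x j else 0 := by
  have hd : ((G.neighborSet i).ncard : ℝ) = ∑ j, if G.Adj i j then (1 : ℝ) else 0 := by
    rw [Finset.sum_boole, ← Set.ncard_coe_finset]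
    congr 2
    ext j
    simp
  have e1 : (degMat G).mulVec x i = ((G.neighborSet i).ncard : ℝ) * x i := by
    simp [Matrix.mulVec, dotProduct, degMat]
  rw [Matrix.add_mulVec, Matrix.smul_mulVec, Pi.add_apply, Pi.smul_apply, e1, hd, smul_eq_mul,
    Finset.sum_mul, Finset.mul_sum]
  simp only [Matrix.mulVec, dotProduct, adjMat]
  rw [← Finset.sum_add_distrib]
  refine Finset.sum_congr rfl fun j _ => ?_
  split_ifs <;> simp

/-- The quadratic form of `α D + A` as a sum over ordered pairs of adjacent vertices. -/
theorem two_mul_dotProduct_alphaMat_mulVec (α : ℝ) (G : SimpleGraph V) (x : V → ℝ) :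
    2 * (x ⬝ᵥ (α • degMat G + adjMat G).mulVec x) =
      ∑ p : V × V with G.Adj p.1 p.2, (α * (x p.1 ^ 2 + x p.2 ^ 2) + 2 * (x p.1 * x p.2)) := by
  have h1 : x ⬝ᵥ (α • degMat G + adjMat G).mulVec x =
      ∑ i, ∑ j, if G.Adj i j then α * x i ^ 2 + x i * x j else 0 := by
    simp only [dotProduct, alphaMat_mulVec, Finset.mul_sum]
    refine Finset.sum_congr rfl fun i _ => Finset.sum_congr rfl fun j _ => ?_
    split_ifs <;> ring
  have h2 : x ⬝ᵥ (α • degMat G + adjMat G).mulVec x =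
      ∑ i, ∑ j, if G.Adj i j then α * x j ^ 2 + x i * x j else 0 := by
    rw [h1, Finset.sum_comm]
    refine Finset.sum_congr rfl fun i _ => Finset.sum_congr rfl fun j _ => ?_
    simp only [G.adj_comm j i]
    split_ifs <;> ring
  rw [two_mul]
  nth_rw 1 [h1]
  rw [h2, Finset.sum_filter, Fintype.sum_prod_type, ← Finset.sum_add_distrib]
  refine Finset.sum_congr rfl fun i _ => ?_
  rw [← Finset.sum_add_distrib]
  refine Finset.sum_congr rfl fun j _ => ?_
  split_ifs <;> ring

theorem pos_of_mulVec_eq_smul {α : ℝ} {G : SimpleGraph V} {x : V → ℝ} {t : ℝ}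
    (hx : x ≠ 0) (h0 : ∀ i, 0 ≤ x i) (h : (α • degMat G + adjMat G).mulVec x = t • x)
    {w : V} (hw : ∀ v, v ≠ w → G.Adj w v) (v : V) : 0 < x v := by
  have key : ∀ i, x i = 0 → ∀ j, G.Adj i j → x j = 0 := by
    intro i hi j hij
    have h1 := congrFun h i
    rw [alphaMat_mulVec, Pi.smul_apply, hi, smul_zero,
      Finset.sum_eq_zero_iff_of_nonneg (fun k _ => by split_ifs <;> simp [h0])] at h1
    simpa [hij] using h1 j (Finset.mem_univ _)
  by_contra hv
  have hv0 : x v = 0 := le_antisymm (not_lt.1 hv) (h0 v)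
  have hw0 : x w = 0 := by
    by_cases hvw : v = w
    · rwa [← hvw]
    · exact key v hv0 w (hw v hvw).symm
  refine hx (funext fun k => ?_)
  by_cases hk : k = w
  · rw [hk]; exact hw0
  · exact key w hw0 k (hw k hk)

/-- If a positive vector has the same image under two matrices `α D + A`, then nested
neighbourhoods coincide. -/
theorem adj_of_mulVec_eq {α : ℝ} (hα : 0 ≤ α) {G H : SimpleGraph V} {x : V → ℝ}
    (hx : ∀ i, 0 < x i) {v : V} (hGH : ∀ w, G.Adj v w → H.Adj v w)
    (h : (α • degMat G + adjMat G).mulVec x v = (α • degMat H + adjMat H).mulVec x v)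
    {w : V} (hw : H.Adj v w) : G.Adj v w := by
  rw [alphaMat_mulVec, alphaMat_mulVec] at h
  have hpos : ∀ j, 0 < α * x v + x j := fun j => by
    have := hx j
    have := (hx v).le
    positivity
  have hle : ∀ j ∈ Finset.univ, (if G.Adj v j then α * x v + x j else 0) ≤
      if H.Adj v j then α * x v + x j else 0 := by
    intro j _
    by_cases h1 : G.Adj v j
    · simp [h1, hGH j h1]
    · rw [if_neg h1]
      split_ifs
      exacts [(hpos j).le, le_rfl]
  have h2 := (Finset.sum_eq_sum_iff_of_le hle).1 h w (Finset.mem_univ _)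
  by_contra h3
  simp only [h3, hw, if_true, if_false] at h2
  exact (hpos w).ne h2

end Spectral

section Extremal

variable {V : Type*}

/-- The graph in which every vertex of `S` is adjacent to all others, the vertices outside
`S ∪ R` form a clique, and those of `R` are adjacent to `S` only. -/
def cliqueWithPendants (S R : Set V) : SimpleGraph V where
  Adj a b := a ≠ b ∧ (a ∈ S ∨ b ∈ S ∨ (a ∉ R ∧ b ∉ R))
  symm := ⟨fun a b h => ⟨h.1.symm, by tauto⟩⟩
  loopless := ⟨fun a h => h.1 rfl⟩

theorem cliqueWithPendants_adj {S R : Set V} {a b : V} :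
    (cliqueWithPendants S R).Adj a b ↔ a ≠ b ∧ (a ∈ S ∨ b ∈ S ∨ (a ∉ R ∧ b ∉ R)) := Iff.rfl

variable [Fintype V]

theorem dotProduct_mulVec_le_cliqueWithPendants {α : ℝ} (hα : 0 ≤ α) {G : SimpleGraph V}
    {S R : Set V} {C : Type*} (κ : V → C) {u : V}
    (hκ : ∀ a b, a ∉ S → b ∉ S → G.Adj a b → κ a = κ b) (hinj : Set.InjOn κ R)
    (huS : u ∉ S) (huR : ∀ r ∈ R, κ r ≠ κ u)
    {x : V → ℝ} (h0 : ∀ i, 0 ≤ x i) (hmax : ∀ v, v ∉ S → x v ≤ x u) :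
    x ⬝ᵥ (α • degMat G + adjMat G).mulVec x ≤
      x ⬝ᵥ (α • degMat (cliqueWithPendants S R) + adjMat (cliqueWithPendants S R)).mulVec x := by
  set T := cliqueWithPendants S R with hT
  have key : ∀ a b, G.Adj a b → ¬ T.Adj a b →
      a ≠ b ∧ a ∉ S ∧ b ∉ S ∧ κ a = κ b ∧ (a ∈ R ∧ b ∉ R ∨ a ∉ R ∧ b ∈ R) := by
    intro a b hab hn
    rw [hT, cliqueWithPendants_adj] at hn
    have hne := hab.ne
    have ha : a ∉ S := fun h => hn ⟨hne, Or.inl h⟩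
    have hb : b ∉ S := fun h => hn ⟨hne, Or.inr (Or.inl h)⟩
    refine ⟨hne, ha, hb, hκ a b ha hb hab, ?_⟩
    by_cases haR : a ∈ R <;> by_cases hbR : b ∈ R
    · exact absurd (hinj haR hbR (hκ a b ha hb hab)) hne
    · exact Or.inl ⟨haR, hbR⟩
    · exact Or.inr ⟨haR, hbR⟩
    · exact absurd ⟨hne, Or.inr (Or.inr ⟨haR, hbR⟩)⟩ hn
  have huR' : u ∉ R := fun h => huR u h rfl
  have hnot : ∀ b, b ∉ S → κ b ≠ κ u → ¬ G.Adj u b := fun b hb h1 h =>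
    h1 (hκ u b huS hb h).symm
  let f : V × V → ℝ := fun p => α * (x p.1 ^ 2 + x p.2 ^ 2) + 2 * (x p.1 * x p.2)
  let φ : V × V → V × V := fun p =>
    if T.Adj p.1 p.2 then p else if p.1 ∈ R then (u, p.2) else (p.1, u)
  have hf0 : ∀ p, 0 ≤ f p := fun p => by
    have := h0 p.1
    have := h0 p.2
    positivity
  have hmaps : ∀ p ∈ Finset.univ.filter (fun p : V × V => G.Adj p.1 p.2),
      φ p ∈ Finset.univ.filter (fun p : V × V => T.Adj p.1 p.2) := by
    rintro ⟨a, b⟩ hp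
    simp only [Finset.mem_filter, Finset.mem_univ, true_and, φ] at hp ⊢
    by_cases hab : T.Adj a b
    · rwa [if_pos hab]
    · obtain ⟨-, -, -, hk, ⟨h1, h2⟩ | ⟨h1, h2⟩⟩ := key a b hp hab
      · rw [if_neg hab, if_pos h1]
        exact ⟨fun h => huR a h1 (hk.trans (congrArg κ h.symm)), Or.inr (Or.inr ⟨huR', h2⟩)⟩
      · rw [if_neg hab, if_neg h1]
        exact ⟨fun h => huR b h2 (hk.symm.trans (congrArg κ h)), Or.inr (Or.inr ⟨h1, huR'⟩)⟩
  have hφinj : Set.InjOn φ (Finset.univ.filter (fun p : V × V => G.Adj p.1 p.2)) := by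
    rintro ⟨a, b⟩ hp ⟨c, d⟩ hp' h
    simp only [Finset.coe_filter, Finset.mem_univ, true_and, Set.mem_ofPred_eq, φ] at hp hp' h
    have hu : ∀ a b, G.Adj a b → ¬ T.Adj a b → κ a ≠ κ u ∧ κ b ≠ κ u := by
      intro a b hp hab
      obtain ⟨-, -, -, hk, ⟨h1, h2⟩ | ⟨h1, h2⟩⟩ := key a b hp hab
      · exact ⟨huR a h1, hk ▸ huR a h1⟩
      · exact ⟨hk ▸ huR b h2, huR b h2⟩
    by_cases hab : T.Adj a b <;> by_cases hcd : T.Adj c d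
    · simpa [hab, hcd] using h
    · obtain ⟨-, hcS, hdS, hk, hR⟩ := key c d hp' hcd
      have hu' := hu c d hp' hcd
      by_cases hc : c ∈ R
      · simp only [hab, hcd, hc, if_true, if_false, Prod.mk.injEq] at h
        rw [h.1, h.2] at hp
        exact absurd hp (hnot d hdS hu'.2)
      · simp only [hab, hcd, hc, if_true, if_false, Prod.mk.injEq] at h
        rw [h.1, h.2] at hp
        exact absurd hp.symm (hnot c hcS hu'.1)
    · obtain ⟨-, hcS, hdS, hk, hR⟩ := key a b hp hab
      have hu' := hu a b hp hab
      by_cases hc : a ∈ R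
      · simp only [hab, hcd, hc, if_true, if_false, Prod.mk.injEq] at h
        rw [← h.1, ← h.2] at hp'
        exact absurd hp' (hnot b hdS hu'.2)
      · simp only [hab, hcd, hc, if_true, if_false, Prod.mk.injEq] at h
        rw [← h.1, ← h.2] at hp'
        exact absurd hp'.symm (hnot a hcS hu'.1)
    · obtain ⟨-, -, -, hk, hR⟩ := key a b hp hab
      obtain ⟨-, -, -, hk', hR'⟩ := key c d hp' hcd
      have hu1 := hu a b hp hab
      have hu2 := hu c d hp' hcd
      by_cases ha : a ∈ R <;> by_cases hc : c ∈ R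
      · simp only [hab, hcd, ha, hc, if_true, if_false, Prod.mk.injEq, true_and] at h
        rw [h, hinj ha hc (by rw [hk, hk', h])]
      · simp only [hab, hcd, ha, hc, if_true, if_false, Prod.mk.injEq] at h
        exact absurd (congrArg κ h.2) hu1.2
      · simp only [hab, hcd, ha, hc, if_true, if_false, Prod.mk.injEq] at h
        exact absurd (congrArg κ h.1) hu1.1
      · simp only [hab, hcd, ha, hc, if_false, Prod.mk.injEq, and_true] at h
        have hb : b ∈ R := by tauto
        have hd : d ∈ R := by tauto
        rw [h, hinj hb hd (by rw [← hk, ← hk', h])]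
  have hle : ∀ p ∈ Finset.univ.filter (fun p : V × V => G.Adj p.1 p.2), f p ≤ f (φ p) := by
    rintro ⟨a, b⟩ hp
    simp only [Finset.mem_filter, Finset.mem_univ, true_and, φ] at hp ⊢
    have ha0 := h0 a
    have hb0 := h0 b
    by_cases hab : T.Adj a b
    · rw [if_pos hab]
    · obtain ⟨-, haS, hbS, -, -⟩ := key a b hp hab
      rw [if_neg hab]
      have h1 := hmax a haS
      have h2 := hmax b hbS
      split_ifs <;> simp only [f] <;> gcongr
  have := calc
    ∑ p : V × V with G.Adj p.1 p.2, f p ≤ ∑ p : V × V with G.Adj p.1 p.2, f (φ p) :=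
      Finset.sum_le_sum hle
    _ = ∑ p ∈ (Finset.univ.filter (fun p : V × V => G.Adj p.1 p.2)).image φ, f p :=
      (Finset.sum_image hφinj).symm
    _ ≤ ∑ p : V × V with T.Adj p.1 p.2, f p :=
      Finset.sum_le_sum_of_subset_of_nonneg (Finset.image_subset_iff.2 hmaps)
        fun p _ _ => hf0 p
  have h1 := two_mul_dotProduct_alphaMat_mulVec α G x
  have h2 := two_mul_dotProduct_alphaMat_mulVec α T x
  simp only [f] at this
  linarith

theorem eq_cliqueWithPendants_of_alphaRadius_le {α : ℝ} (hα : 0 ≤ α) {G : SimpleGraph V}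
    {S R : Set V} {C : Type*} (κ : V → C) {w : V} (hw : w ∈ S) {u : V}
    (hκ : ∀ a b, a ∉ S → b ∉ S → G.Adj a b → κ a = κ b) (hinj : Set.InjOn κ R)
    (huS : u ∉ S) (huR : ∀ r ∈ R, κ r ≠ κ u)
    {x : V → ℝ} (hx : x ≠ 0) (h0 : ∀ i, 0 ≤ x i) (hmax : ∀ v, v ∉ S → x v ≤ x u)
    (hxG : (α • degMat G + adjMat G).mulVec x = alphaRadius α G • x)
    (hle : alphaRadius α (cliqueWithPendants S R) ≤ alphaRadius α G) :
    G = cliqueWithPendants S R := by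
  set T := cliqueWithPendants S R with hT
  have hxx : 0 < x ⬝ᵥ x :=
    lt_of_le_of_ne (Finset.sum_nonneg fun i _ => mul_self_nonneg _)
      fun h => hx (dotProduct_self_eq_zero.1 h.symm)
  have hQ := dotProduct_mulVec_le_cliqueWithPendants hα κ hκ hinj huS huR h0 hmax
  rw [← hT, hxG, dotProduct_smul, smul_eq_mul] at hQ
  have hT1 := dotProduct_mulVec_le_specRad (alphaMat_isHermitian α T) x
  change _ ≤ alphaRadius α T * _ at hT1
  have heq : alphaRadius α T = alphaRadius α G :=
    le_antisymm hle (le_of_mul_le_mul_right (hQ.trans hT1) hxx)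
  have hxT : (α • degMat T + adjMat T).mulVec x = alphaRadius α T • x :=
    mulVec_eq_specRad_smul (alphaMat_isHermitian α T) (by
      change alphaRadius α T * _ ≤ _
      rwa [heq])
  have hpos := pos_of_mulVec_eq_smul hx h0 hxT (w := w) fun v hv => ⟨hv.symm, Or.inl hw⟩
  have hrow : (α • degMat G + adjMat G).mulVec x = (α • degMat T + adjMat T).mulVec x := by
    rw [hxG, hxT, heq]
  have huR' : u ∉ R := fun h => huR u h rfl
  have hu : ∀ v, T.Adj u v → G.Adj u v := by
    refine fun v hv => adj_of_mulVec_eq hα hpos (fun b hb => ?_) (congrFun hrow u) hv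
    refine ⟨hb.ne, ?_⟩
    by_cases hbS : b ∈ S
    · exact Or.inr (Or.inl hbS)
    · exact Or.inr (Or.inr ⟨huR', fun hbR => huR b hbR (hκ u b huS hbS hb).symm⟩)
  have hK : ∀ v, v ∉ S → v ∉ R → κ v = κ u := by
    intro v hvS hvR
    by_cases h : u = v
    · rw [h]
    · exact (hκ u v huS hvS (hu v ⟨h, Or.inr (Or.inr ⟨huR', hvR⟩)⟩)).symm
  have hGT : ∀ a b, G.Adj a b → T.Adj a b := by
    intro a b hab
    refine ⟨hab.ne, ?_⟩
    by_contra hcon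
    push Not at hcon
    obtain ⟨haS, hbS, h⟩ := hcon
    have hk := hκ a b haS hbS hab
    by_cases ha : a ∈ R
    · by_cases hb : b ∈ R
      · exact hab.ne (hinj ha hb hk)
      · exact huR a ha (hk.trans (hK b hbS hb))
    · exact huR b (h ha) (hk.symm.trans (hK a haS ha))
  ext a b
  exact ⟨hGT a b, adj_of_mulVec_eq hα hpos (hGT a) (congrFun hrow a)⟩

end Extremal

section Matching

variable {V : Type*} [Fintype V]

theorem two_mul_ncard_edgeSet_of_isMatching {G : SimpleGraph V} {M : G.Subgraph}
    (hM : M.IsMatching) : 2 * M.edgeSet.ncard = M.verts.ncard := by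
  have h := M.spanningCoe.sum_degrees_eq_twice_card_edges
  have h1 : M.spanningCoe.edgeFinset.card = M.edgeSet.ncard := by
    rw [← Set.ncard_coe_finset, SimpleGraph.coe_edgeFinset, SimpleGraph.Subgraph.edgeSet_spanningCoe]
  have h2 : ∀ v, M.spanningCoe.degree v = if v ∈ M.verts then 1 else 0 := by
    intro v
    split_ifs with hv
    · rw [SimpleGraph.degree_eq_one_iff_existsUnique_adj]
      exact hM hv
    · rw [SimpleGraph.degree_eq_zero]
      intro w hw
      exact hv (M.edge_vert hw)
  rw [← h1, ← h, Finset.sum_congr rfl fun v _ => h2 v, Finset.sum_boole, ← Set.ncard_coe_finset]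
  simp

theorem bddAbove_ncard_edgeSet (G : SimpleGraph V) :
    BddAbove {m : ℕ | ∃ M : G.Subgraph, M.IsMatching ∧ M.edgeSet.ncard = m} := by
  refine ⟨Fintype.card V, ?_⟩
  rintro _ ⟨M, hM, rfl⟩
  have h1 := two_mul_ncard_edgeSet_of_isMatching hM
  have h2 := Set.ncard_le_card M.verts
  rw [Nat.card_eq_fintype_card] at h2
  omega

theorem ncard_verts_le_two_mul_matchingNumber {G : SimpleGraph V} {M : G.Subgraph}
    (hM : M.IsMatching) : M.verts.ncard ≤ 2 * matchingNumber G := by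
  rw [← two_mul_ncard_edgeSet_of_isMatching hM]
  exact Nat.mul_le_mul_left 2 (le_csSup (bddAbove_ncard_edgeSet G) ⟨M, hM, rfl⟩)

theorem matchingNumber_le {G : SimpleGraph V} {k : ℕ}
    (h : ∀ M : G.Subgraph, M.IsMatching → M.verts.ncard ≤ 2 * k + 1) : matchingNumber G ≤ k := by
  refine csSup_le' ?_
  rintro _ ⟨M, hM, rfl⟩
  have := h M hM
  have := two_mul_ncard_edgeSet_of_isMatching hM
  omega

theorem matchingNumber_cliqueWithPendants {S R : Set V} (hRS : Disjoint S R) {m : ℕ}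
    (hK : (S ∪ R)ᶜ.ncard = 2 * m + 1) (hle : S.ncard ≤ R.ncard) :
    matchingNumber (cliqueWithPendants S R) = S.ncard + m := by
  apply le_antisymm
  · refine matchingNumber_le fun M hM => ?_
    have h1 : M.verts ⊆ S ∪ (S ∪ R)ᶜ ∪ (M.verts ∩ R) := by
      intro v hv
      by_cases h : v ∈ S <;> by_cases h' : v ∈ R <;> simp [h, h', hv]
    have h2 : (M.verts ∩ R).ncard ≤ S.ncard := by
      have hex : ∀ v, ∃ w, v ∈ M.verts → M.Adj v w := fun v => by
        by_cases hv : v ∈ M.verts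
        · obtain ⟨w, hw, -⟩ := hM hv
          exact ⟨w, fun _ => hw⟩
        · exact ⟨v, fun h => absurd h hv⟩
      choose p hp using hex
      refine Set.ncard_le_ncard_of_injOn p (fun v hv => ?_) (fun v hv w hw h => ?_)
      · have hadj := M.adj_sub (hp v hv.1)
        rw [cliqueWithPendants_adj] at hadj
        have : v ∉ S := fun h => Set.disjoint_left.1 hRS h hv.2
        have := hv.2
        tauto
      · exact hM.eq_of_adj_right (hp v hv.1) (h ▸ hp w hw.1)
    have h3 := Set.ncard_le_ncard h1
    have h4 := Set.ncard_union_le (S ∪ (S ∪ R)ᶜ) (M.verts ∩ R)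
    have h5 := Set.ncard_union_le S (S ∪ R)ᶜ
    omega
  · obtain ⟨R', hR', hcard⟩ := Set.exists_subset_card_eq hle
    have hSR' : Disjoint S R' := hRS.mono_right hR'
    let e : S ≃ R' := (Finite.equivFinOfCardEq (Nat.card_coe_set_eq S)).trans
      (Finite.equivFinOfCardEq ((Nat.card_coe_set_eq R').trans hcard)).symm
    obtain ⟨M₁, hM₁, hM₁'⟩ := SimpleGraph.Subgraph.IsMatching.exists_of_disjoint_sets_of_equiv
      (G := cliqueWithPendants S R) hSR' e
      fun v => ⟨hSR'.ne_of_mem v.2 (e v).2, Or.inl v.2⟩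
    obtain ⟨u, hu⟩ : ((S ∪ R)ᶜ).Nonempty := by
      apply Set.nonempty_of_ncard_ne_zero
      omega
    have hK' : ((S ∪ R)ᶜ \ {u}).ncard = 2 * m := by
      rw [Set.ncard_sdiff_singleton_of_mem hu, hK]
      rfl
    have hclique : (cliqueWithPendants S R).IsClique ((S ∪ R)ᶜ \ {u}) := by
      intro a ha b hb hne
      exact ⟨hne, Or.inr (Or.inr ⟨fun h => ha.1 (Or.inr h), fun h => hb.1 (Or.inr h)⟩)⟩
    obtain ⟨M₂, hM₂, hM₂'⟩ := (hclique.even_iff_exists_isMatching (Set.toFinite _)).1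
      (by rw [hK']; exact even_two_mul m)
    have hdis : Disjoint (S ∪ R') ((S ∪ R)ᶜ \ {u}) := by
      refine Set.disjoint_left.2 fun a ha hb => hb.1 ?_
      exact ha.imp id fun h => hR' h
    have hM := hM₁'.sup hM₂' (by
      rwa [hM₁'.support_eq_verts, hM₂'.support_eq_verts, hM₁, hM₂])
    have h := ncard_verts_le_two_mul_matchingNumber hM
    rw [SimpleGraph.Subgraph.verts_sup, hM₁, hM₂, Set.ncard_union_eq hdis,
      Set.ncard_union_eq hSR', hcard, hK'] at h
    omega

end Matching

section TutteBerge

theorem ncard_oddComponents_le_of_iso {A B : Type*} [Finite B] {G : SimpleGraph A}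
    {H : SimpleGraph B} (φ : G ≃g H) : G.oddComponents.ncard ≤ H.oddComponents.ncard := by
  refine Set.ncard_le_ncard_of_injOn φ.connectedComponentEquiv (fun c hc => ?_)
    φ.connectedComponentEquiv.injective.injOn
  have h := Nat.card_congr (SimpleGraph.ConnectedComponent.isoEquivSupp φ c)
  rw [Nat.card_coe_set_eq, Nat.card_coe_set_eq] at h
  change Odd c.supp.ncard at hc
  rw [h] at hc
  exact hc

variable {V : Type*}

/-- The graph obtained from `G` by adding `d` vertices adjacent to everything. -/
def addUniversal (G : SimpleGraph V) (d : ℕ) : SimpleGraph (V ⊕ Fin d) where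
  Adj a b := a ≠ b ∧ ∀ v w, a = Sum.inl v → b = Sum.inl w → G.Adj v w
  symm := ⟨fun _ _ h => ⟨h.1.symm, fun v w hv hw => (h.2 w v hw hv).symm⟩⟩
  loopless := ⟨fun _ h => h.1 rfl⟩

variable [Fintype V]

theorem not_isTutteViolator_addUniversal {G : SimpleGraph V} {d : ℕ}
    (hd : ∀ U : Set V, oddComponentsOutside G U ≤ U.ncard + d) (heven : Even (Fintype.card V + d))
    (U : Set (V ⊕ Fin d)) : ¬ (addUniversal G d).IsTutteViolator U := by
  intro hU
  unfold SimpleGraph.IsTutteViolator at hU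
  set H := ((⊤ : (addUniversal G d).Subgraph).deleteVerts U).coe with hH
  by_cases hall : ∀ i, Sum.inr i ∈ U
  · have hcard : U.ncard = (Sum.inl ⁻¹' U).ncard + d := by
      have h1 : U = Sum.inl '' (Sum.inl ⁻¹' U) ∪ Set.range Sum.inr := by
        ext a
        rcases a with a | i
        · simp
        · simp [hall i]
      have h2 : Disjoint (Sum.inl '' (Sum.inl ⁻¹' U)) (Set.range (Sum.inr : Fin d → V ⊕ Fin d)) := by
        rw [Set.disjoint_left]
        rintro _ ⟨v, -, rfl⟩ ⟨i, hi⟩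
        cases hi
      conv_lhs => rw [h1]
      rw [Set.ncard_union_eq h2, Set.ncard_image_of_injective _ Sum.inl_injective,
        ← Set.image_univ, Set.ncard_image_of_injective _ Sum.inr_injective, Set.ncard_univ,
        Nat.card_eq_fintype_card, Fintype.card_fin]
    let f : ↥((Sum.inl ⁻¹' U)ᶜ : Set V) → ((⊤ : (addUniversal G d).Subgraph).deleteVerts U).verts :=
      fun v => ⟨Sum.inl v.1, trivial, v.2⟩
    have hf : Function.Bijective f := by
      constructor
      · intro v w h
        exact Subtype.ext (Sum.inl_injective (Subtype.ext_iff.1 h))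
      · rintro ⟨a | i, -, ha⟩
        · exact ⟨⟨a, ha⟩, rfl⟩
        · exact absurd (hall i) ha
    let φ : G.induce (Sum.inl ⁻¹' U)ᶜ ≃g H :=
      { toEquiv := Equiv.ofBijective f hf
        map_rel_iff' := by
          rintro ⟨v, hv⟩ ⟨w, hw⟩
          simp only [hH, f, Equiv.ofBijective_apply, SimpleGraph.Subgraph.coe_adj,
            SimpleGraph.Subgraph.deleteVerts_adj, SimpleGraph.comap_adj]
          constructor
          · exact fun h => h.2.2.2.2.2 v w rfl rfl
          · exact fun h => ⟨trivial, hv, trivial, hw, fun h' => h.ne (Sum.inl_injective h'),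
              fun _ _ ha hb => Sum.inl_injective ha ▸ Sum.inl_injective hb ▸ h⟩ }
    have h1 := ncard_oddComponents_le_of_iso φ.symm
    have h2 : (G.induce (Sum.inl ⁻¹' U)ᶜ).oddComponents.ncard ≤ (Sum.inl ⁻¹' U).ncard + d := hd _
    omega
  · push Not at hall
    obtain ⟨i, hi⟩ := hall
    let z : ((⊤ : (addUniversal G d).Subgraph).deleteVerts U).verts := ⟨Sum.inr i, trivial, hi⟩
    have hz : ∀ a, H.Reachable z a := by
      intro a
      by_cases h : z = a
      · rw [h]
      · refine SimpleGraph.Adj.reachable ?_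
        simp only [hH, SimpleGraph.Subgraph.coe_adj, SimpleGraph.Subgraph.deleteVerts_adj]
        refine ⟨trivial, hi, trivial, a.2.2, ?_⟩
        refine ⟨fun h' => h (Subtype.ext h'), fun v w hv => ?_⟩
        cases hv
    have hsub : Subsingleton H.ConnectedComponent := by
      constructor
      intro c c'
      induction c using SimpleGraph.ConnectedComponent.ind
      induction c' using SimpleGraph.ConnectedComponent.ind
      exact SimpleGraph.ConnectedComponent.sound ((hz _).symm.trans (hz _))
    have h1 : H.oddComponents.ncard ≤ 1 := Set.ncard_le_one_of_subsingleton _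
    have hU0 : U = ∅ := (Set.ncard_eq_zero (Set.toFinite U)).1 (by omega)
    have h2 : Odd H.oddComponents.ncard := by
      rw [show H.oddComponents.ncard = 1 by omega]
      exact odd_one
    rw [SimpleGraph.odd_ncard_oddComponents, Nat.card_coe_set_eq,
      SimpleGraph.Subgraph.deleteVerts_verts, hU0, Set.sdiff_empty,
      SimpleGraph.Subgraph.verts_top, Set.ncard_univ, Nat.card_eq_fintype_card,
      Fintype.card_sum, Fintype.card_fin] at h2
    exact (Nat.not_odd_iff_even.2 heven) h2

/-- The nontrivial inequality of the Tutte–Berge formula. -/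
theorem card_le_two_mul_matchingNumber_add {G : SimpleGraph V} {d : ℕ}
    (hd : ∀ U : Set V, oddComponentsOutside G U ≤ U.ncard + d)
    (heven : Even (Fintype.card V + d)) : Fintype.card V ≤ 2 * matchingNumber G + d := by
  obtain ⟨M, hM, hMs⟩ := SimpleGraph.tutte.2 (not_isTutteViolator_addUniversal hd heven)
  let N : G.Subgraph :=
    { verts := {v | ∃ w, M.Adj (Sum.inl v) (Sum.inl w)}
      Adj := fun v w => M.Adj (Sum.inl v) (Sum.inl w)
      adj_sub := fun {v w} h => (M.adj_sub h).2 v w rfl rfl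
      edge_vert := fun {v w} h => ⟨w, h⟩
      symm := ⟨fun _ _ h => h.symm⟩ }
  have hN : N.IsMatching := by
    rintro v ⟨w, hw⟩
    exact ⟨w, hw, fun w' hw' => Sum.inl_injective (hM.eq_of_adj_left hw' hw)⟩
  have h1 := ncard_verts_le_two_mul_matchingNumber hN
  have h2 : N.vertsᶜ.ncard ≤ d := by
    choose p hp using fun v => (hM (hMs v)).exists
    have h3 : N.vertsᶜ.ncard ≤ (Set.range (Sum.inr : Fin d → V ⊕ Fin d)).ncard := by
      refine Set.ncard_le_ncard_of_injOn (fun v => p (Sum.inl v)) (fun v hv => ?_)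
        fun v _ w _ h => ?_
      · have hpv := hp (Sum.inl v)
        rcases h : p (Sum.inl v) with w | i
        · rw [h] at hpv
          exact absurd ⟨w, hpv⟩ hv
        · simp
      · have h' : p (Sum.inl v) = p (Sum.inl w) := h
        exact Sum.inl_injective (hM.eq_of_adj_right (hp (Sum.inl v)) (h' ▸ hp (Sum.inl w)))
    rwa [← Set.image_univ, Set.ncard_image_of_injective _ Sum.inr_injective, Set.ncard_univ,
      Nat.card_eq_fintype_card, Fintype.card_fin] at h3
  have h3 := Set.ncard_add_ncard_compl N.verts
  rw [Nat.card_eq_fintype_card] at h3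
  omega

end TutteBerge

theorem nonempty_iso_cliqueWithPendants {V : Type*} [Fintype V] {S R : Set V}
    (hRS : Disjoint S R) {s k r : ℕ} (hs : S.ncard = s) (hk : (S ∪ R)ᶜ.ncard = k)
    (hr : R.ncard = r) :
    Nonempty (cliqueWithPendants S R ≃g graphJoin (⊤ : SimpleGraph (Fin s))
      (graphSum (⊤ : SimpleGraph (Fin k)) (⊥ : SimpleGraph (Fin r)))) := by
  let eS := Finite.equivFinOfCardEq ((Nat.card_coe_set_eq S).trans hs)
  let eK := Finite.equivFinOfCardEq ((Nat.card_coe_set_eq (S ∪ R)ᶜ).trans hk)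
  let eR := Finite.equivFinOfCardEq ((Nat.card_coe_set_eq R).trans hr)
  let f : Fin s ⊕ (Fin k ⊕ Fin r) → V := Sum.elim (fun i => (eS.symm i).1)
    (Sum.elim (fun i => (eK.symm i).1) (fun i => (eR.symm i).1))
  have h1 : ∀ i, (eS.symm i).1 ∈ S := fun i => (eS.symm i).2
  have h2 : ∀ i, (eK.symm i).1 ∉ S := fun i h => (eK.symm i).2 (Or.inl h)
  have h3 : ∀ i, (eK.symm i).1 ∉ R := fun i h => (eK.symm i).2 (Or.inr h)
  have h4 : ∀ i, (eR.symm i).1 ∈ R := fun i => (eR.symm i).2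
  have h5 : ∀ i, (eR.symm i).1 ∉ S := fun i h => Set.disjoint_left.1 hRS h (h4 i)
  have hinj : Function.Injective f := by
    rintro (i | i | i) (j | j | j) h <;> simp only [f, Sum.elim_inl, Sum.elim_inr] at h
    · rw [eS.symm.injective (Subtype.ext h)]
    · exact absurd (h ▸ h1 i) (h2 j)
    · exact absurd (h ▸ h1 i) (h5 j)
    · exact absurd (h ▸ h1 j) (h2 i)
    · rw [eK.symm.injective (Subtype.ext h)]
    · exact absurd (h ▸ h4 j) (h3 i)
    · exact absurd (h ▸ h1 j) (h5 i)
    · exact absurd (h ▸ h4 i) (h3 j)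
    · rw [eR.symm.injective (Subtype.ext h)]
  have hsurj : Function.Surjective f := by
    intro v
    by_cases hS : v ∈ S
    · exact ⟨Sum.inl (eS ⟨v, hS⟩), by simp [f]⟩
    by_cases hR : v ∈ R
    · exact ⟨Sum.inr (Sum.inr (eR ⟨v, hR⟩)), by simp [f]⟩
    · exact ⟨Sum.inr (Sum.inl (eK ⟨v, fun h => h.elim hS hR⟩)), by simp [f]⟩
  let φ : graphJoin (⊤ : SimpleGraph (Fin s))
      (graphSum (⊤ : SimpleGraph (Fin k)) (⊥ : SimpleGraph (Fin r))) ≃g cliqueWithPendants S R :=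
    { toEquiv := Equiv.ofBijective f ⟨hinj, hsurj⟩
      map_rel_iff' := by
        intro a b
        change (cliqueWithPendants S R).Adj (f a) (f b) ↔ _
        rw [cliqueWithPendants_adj, hinj.ne_iff]
        rcases a with i | i | i <;> rcases b with j | j | j <;>
          simp [f, graphJoin, graphSum, h1, h2, h3, h4, h5, eq_comm] }
  exact ⟨φ.symm⟩

theorem stmt15 (α : ℝ) (hα : 0 ≤ α) (n β s q : ℕ) (hβ : 1 ≤ β) (hn : 2 * β + 1 ≤ n)
    (G : SimpleGraph (Fin n)) (hm : matchingNumber G = β)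
    (hmax : ∀ H : SimpleGraph (Fin n),
      matchingNumber H = β → alphaRadius α H ≤ alphaRadius α G)
    (S : Set (Fin n)) (hS : S.ncard = s) (hs : 1 ≤ s)
    (hTB : ∀ T : Set (Fin n),
      (n : ℤ) - oddComponentsOutside G S + S.ncard ≤
        (n : ℤ) - oddComponentsOutside G T + T.ncard)
    (hq : q = n + s - 2 * β) :
    Nonempty (G ≃g graphJoin (⊤ : SimpleGraph (Fin s))
      (graphSum (⊤ : SimpleGraph (Fin (2 * β - 2 * s + 1)))
        (⊥ : SimpleGraph (Fin (q - 1))))) := by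
  have hVcard : Fintype.card (Fin n) = n := Fintype.card_fin n
  have hSc : S.ncard + Sᶜ.ncard = n := by
    rw [Set.ncard_add_ncard_compl, Nat.card_eq_fintype_card, hVcard]
  set o := oddComponentsOutside G S with ho
  have hpar : Odd o ↔ Odd Sᶜ.ncard := by
    have := (G.induce Sᶜ).odd_ncard_oddComponents
    rwa [Nat.card_coe_set_eq] at this
  have hso : s ≤ o := by
    have h := hTB ∅
    rw [Set.ncard_empty, hS] at h
    omega
  have hn2 : n ≤ 2 * β + (o - s) := by
    have h := card_le_two_mul_matchingNumber_add (G := G) (d := o - s) (fun U => by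
      have h := hTB U
      omega) (by
      rw [hVcard]
      grind)
    rwa [hVcard, hm] at h
  have hocard : o ≤ Nat.card (G.induce Sᶜ).ConnectedComponent := Set.ncard_le_card _
  have hcomp : Nat.card (G.induce Sᶜ).ConnectedComponent ≤ Sᶜ.ncard := by
    rw [← Nat.card_coe_set_eq]
    exact Nat.card_le_card_of_surjective (G.induce Sᶜ).connectedComponentMk Quot.mk_surjective
  have hne : Nonempty (Fin n) := ⟨⟨0, by omega⟩⟩
  obtain ⟨x, hx, h0, hxG⟩ :=
    exists_nonneg_eigenvector (alphaMat_isHermitian α G) (alphaMat_nonneg hα G)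
  obtain ⟨u, huS, hmaxu⟩ := Set.exists_max_image Sᶜ x (Set.toFinite _)
    (Set.nonempty_of_ncard_ne_zero (by omega))
  obtain ⟨t, ht, htcard⟩ := Set.exists_subset_card_eq
    (s := {(G.induce Sᶜ).connectedComponentMk ⟨u, huS⟩}ᶜ) (n := q - 1) (by
      have := Set.ncard_add_ncard_compl {(G.induce Sᶜ).connectedComponentMk ⟨u, huS⟩}
      rw [Set.ncard_singleton] at this
      omega)
  let rep : (G.induce Sᶜ).ConnectedComponent → Fin n := fun c => (Quot.out c).1
  let κ : Fin n → Option (G.induce Sᶜ).ConnectedComponent := fun v =>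
    if h : v ∈ Sᶜ then some ((G.induce Sᶜ).connectedComponentMk ⟨v, h⟩) else none
  have hrepS : ∀ c, rep c ∈ Sᶜ := fun c => (Quot.out c).2
  have hκrep : ∀ c, κ (rep c) = some c := fun c => by
    simp only [κ, dif_pos (hrepS c)]
    exact congrArg some (Quot.out_eq c)
  have hrepinj : Function.Injective rep := fun c c' h => by
    have h' := congrArg κ h
    rwa [hκrep, hκrep, Option.some_inj] at h'
  have hdis : Disjoint S (rep '' t) := by
    rw [Set.disjoint_left]
    rintro _ h ⟨c, -, rfl⟩
    exact hrepS c h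
  have hRcard : (rep '' t).ncard = q - 1 := by
    rw [Set.ncard_image_of_injective _ hrepinj, htcard]
  have hKcard : (S ∪ rep '' t)ᶜ.ncard = 2 * (β - s) + 1 := by
    have h := Set.ncard_add_ncard_compl (S ∪ rep '' t)
    rw [Set.ncard_union_eq hdis, hRcard, Nat.card_eq_fintype_card, hVcard] at h
    omega
  have hGT : G = cliqueWithPendants S (rep '' t) := by
    obtain ⟨w, hw⟩ : S.Nonempty := Set.nonempty_of_ncard_ne_zero (by omega)
    refine eq_cliqueWithPendants_of_alphaRadius_le hα κ hw (fun a b ha hb hab => ?_) ?_ huS ?_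
      hx h0 (fun v hv => hmaxu v hv) hxG (hmax _ ?_)
    · have ha' : a ∈ Sᶜ := ha
      have hb' : b ∈ Sᶜ := hb
      simp only [κ, dif_pos ha', dif_pos hb']
      exact congrArg some (SimpleGraph.ConnectedComponent.sound
        (SimpleGraph.Adj.reachable (G := G.induce Sᶜ) (u := ⟨a, ha'⟩) (v := ⟨b, hb'⟩) hab))
    · rintro _ ⟨c, -, rfl⟩ _ ⟨c', -, rfl⟩ h
      rw [hκrep, hκrep, Option.some_inj] at h
      rw [h]
    · rintro _ ⟨c, hc, rfl⟩ h
      rw [hκrep] at h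
      simp only [κ, dif_pos huS, Option.some_inj] at h
      exact ht hc h
    · rw [matchingNumber_cliqueWithPendants hdis hKcard (by omega)]
      omega
  rw [hGT]
  exact nonempty_iso_cliqueWithPendants hdis hS (by omega) hRcard
end
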